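/- Let H be a finite group with normal subgroup Q which is similar to a 3-centralizer in a group of type F₂. Let r be an element of H of order 2 whose image in H/Q lies in O₂(H/Q) but not in the center Z(O₂(H/Q)). Then O₂(C_H(r)) is extraspecial of order 2⁵ whose maximal elementary abelian subgroups have order 4 (type 2^{1+4}_-), and O₂(C_H(r)) is the unique maximal C_Q(r)-signalizer in C_H(r): every C_Q(r)-invariant subgroup of C_H(r) of order coprime to 3 is contained in O₂(C_H(r)). -/

import Mathlib

/-- `O_p(X)`: the largest normal `p`-subgroup of the group `X` (for finite `X` this is the
`p`-core), defined as the join of all normal `p`-subgroups. -/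
def Op (p : ℕ) (X : Type*) [Group X] : Subgroup X :=
  sSup {P : Subgroup X | P.Normal ∧ IsPGroup p P}

theorem map_conjAut_eq_of_normal {X : Type*} [Group X] (g : X) {P : Subgroup X}
    (hP : P.Normal) : Subgroup.map (MulAut.conj g).toMonoidHom P = P := by
  ext x
  simp only [Subgroup.mem_map, MulEquiv.coe_toMonoidHom, MulAut.conj_apply]
  constructor
  · rintro ⟨y, hy, rfl⟩
    exact hP.conj_mem y hy g
  · intro hx
    refine ⟨g⁻¹ * x * g, by simpa using hP.conj_mem x hx g⁻¹, by group⟩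

instance Op.normal (p : ℕ) (X : Type*) [Group X] : (Op p X).Normal := by
  constructor
  intro n hn g
  have key : Subgroup.map (MulAut.conj g).toMonoidHom (Op p X) = Op p X := by
    unfold Op
    rw [(Subgroup.gc_map_comap _).l_sSup]
    apply le_antisymm
    · refine iSup_le fun P => iSup_le fun hP => ?_
      rw [map_conjAut_eq_of_normal g hP.1]
      exact le_sSup hP
    · refine sSup_le fun P hP => ?_
      refine le_trans (le_of_eq (map_conjAut_eq_of_normal g hP.1).symm) ?_
      exact le_iSup₂_of_le P hP le_rfl
  rw [← key]
  exact Subgroup.mem_map.mpr ⟨n, hn, by simp⟩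

/-- A finite `p`-group is extraspecial if its center, derived subgroup and Frattini subgroup
coincide and have order `p`. -/
def IsExtraspecial (p : ℕ) (P : Type*) [Group P] : Prop :=
  IsPGroup p P ∧ Subgroup.center P = commutator P ∧ Subgroup.center P = frattini P ∧
    Nat.card (Subgroup.center P) = p

/-- The symplectic group `Sp₄(GF(3))`. -/
abbrev Sp43 := Matrix.symplecticGroup (Fin 2) (ZMod 3)

/-- `PSp₄(3) ≅ Ω₆⁻(2)`, the quotient of `Sp₄(GF(3))` by its center. -/
abbrev PSp43 := Sp43 ⧸ Subgroup.center Sp43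

/-- A finite group `H` with a normal subgroup `Q` is similar to a 3-centralizer in a group of
type `M(23)` or `F₂` (Definitions 1.1 and 1.2 of the paper): `Q = F*(H) = O₃(H) ≅ 3^{1+8}_+`
with `Z(Q) = Z(H)`, `O₂(H/Q) ≅ 2^{1+6}_-` with `F*(H/Q) = O₂(H/Q)`, and `(H/Q)/O₂(H/Q)` is
isomorphic to `PSp₄(3)` (type `F₂`) or to the centralizer of a 3-central element of `PSp₄(3)`
(type `M(23)`). -/
structure SimilarToM23orF2Centralizer (H : Type*) [Group H] [Finite H]
    (Q : Subgroup H) [Q.Normal] : Prop where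
  extraspecial : IsExtraspecial 3 Q
  card_eq : Nat.card Q = 3 ^ 9
  exponent3 : ∀ x ∈ Q, x ^ 3 = 1
  centralizer_eq : Subgroup.centralizer (Q : Set H) = Subgroup.center H
  center_le : Subgroup.center H ≤ Q
  O2_extraspecial : IsExtraspecial 2 (Op 2 (H ⧸ Q))
  O2_card : Nat.card (Op 2 (H ⧸ Q)) = 2 ^ 7
  O2_minusType : ∀ A : Subgroup (H ⧸ Q), A ≤ Op 2 (H ⧸ Q) → (∀ x ∈ A, x ^ 2 = 1) →
    Nat.card A ≤ 2 ^ 3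
  O2_selfCentralizing :
    Subgroup.centralizer ((Op 2 (H ⧸ Q)) : Set (H ⧸ Q)) ≤ Op 2 (H ⧸ Q)
  quotient_iso :
    Nonempty (((H ⧸ Q) ⧸ Op 2 (H ⧸ Q)) ≃* PSp43) ∨
    ∃ (z : PSp43) (S : Sylow 3 PSp43), orderOf z = 3 ∧ z ∈ (S : Subgroup PSp43) ∧
      z ∈ Subgroup.centralizer ((S : Subgroup PSp43) : Set PSp43) ∧
      Nonempty (((H ⧸ Q) ⧸ Op 2 (H ⧸ Q)) ≃* Subgroup.centralizer {z})

/-- A finite group `H` with a normal subgroup `Q` is similar to a 3-centralizer in a group of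
type `F₂` (Definition 1.2 of the paper). -/
structure SimilarToF2Centralizer (H : Type*) [Group H] [Finite H]
    (Q : Subgroup H) [Q.Normal] : Prop where
  extraspecial : IsExtraspecial 3 Q
  card_eq : Nat.card Q = 3 ^ 9
  exponent3 : ∀ x ∈ Q, x ^ 3 = 1
  centralizer_eq : Subgroup.centralizer (Q : Set H) = Subgroup.center H
  center_le : Subgroup.center H ≤ Q
  O2_extraspecial : IsExtraspecial 2 (Op 2 (H ⧸ Q))
  O2_card : Nat.card (Op 2 (H ⧸ Q)) = 2 ^ 7
  O2_minusType : ∀ A : Subgroup (H ⧸ Q), A ≤ Op 2 (H ⧸ Q) → (∀ x ∈ A, x ^ 2 = 1) →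
    Nat.card A ≤ 2 ^ 3
  O2_selfCentralizing :
    Subgroup.centralizer ((Op 2 (H ⧸ Q)) : Set (H ⧸ Q)) ≤ Op 2 (H ⧸ Q)
  quotient_iso : Nonempty (((H ⧸ Q) ⧸ Op 2 (H ⧸ Q)) ≃* PSp43)

section ES
set_option linter.unusedSectionVars false
open Classical

/-- Type-level description of an extraspecial 2-group of order `2^7` of minus type. -/
structure ES (E : Type*) [Group E] [Fintype E] (z : E) : Prop where
  z1 : z ≠ 1
  zc : ∀ x, x * z = z * x
  z2 : z * z = 1
  sq : ∀ x, x * x = 1 ∨ x * x = z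
  cm : ∀ x y, x * y = y * x ∨ x * y = z * (y * x)
  cen : ∀ x, (∀ y, x * y = y * x) → x = 1 ∨ x = z
  card : Fintype.card E = 128
  min : ∀ A : Subgroup E, (∀ x ∈ A, x * x = 1) → Nat.card A ≤ 8

variable {E : Type*} [Group E] [Fintype E] {z : E}

noncomputable def eps (x : E) : ℤ := if x * x = 1 then 1 else -1
noncomputable def sg (x y : E) : ℤ := if x * y = y * x then 1 else -1

theorem eps_mul (h : ES E z) (x y : E) : eps (x * y) = eps x * eps y * sg x y := by
  have hz1 := h.z1
  have key : x * y * (x * y) = (x * x) * (y * y) * (if x * y = y * x then 1 else z) := by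
    split_ifs with hc
    · calc x * y * (x * y) = x * (y * x) * y := by group
        _ = x * (x * y) * y := by rw [hc]
        _ = _ := by group
    · have h1 : y * x = z * (x * y) := by
        rcases h.cm y x with h2 | h2
        · exact absurd h2.symm hc
        · exact h2
      calc x * y * (x * y) = x * (y * x) * y := by group
        _ = x * (z * (x * y)) * y := by rw [h1]
        _ = (x * z) * x * (y * y) := by group
        _ = z * (x * x * (y * y)) := by rw [h.zc]; group
        _ = _ := by rw [h.zc]
  unfold eps sg
  rw [key]
  rcases h.sq x with h1 | h1 <;> rcases h.sq y with h2 | h2 <;> rw [h1, h2] <;>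
    split_ifs <;> simp_all [h.z2]

theorem sg_mul_left (h : ES E z) (x y w : E) : sg (x * y) w = sg x w * sg y w := by
  have hz1 := h.z1
  unfold sg
  have e1 : x * y * w = x * (y * w) := by group
  have e2 : w * (x * y) = (w * x) * y := by group
  have hcx : ∀ a b : E, a * b ≠ b * a → a * b = z * (b * a) := fun a b hab =>
    (h.cm a b).resolve_left hab
  by_cases hy : y * w = w * y
  · by_cases hx : x * w = w * x
    · have : x * y * w = w * (x * y) := by
        rw [e1, hy, ← mul_assoc, hx, mul_assoc]
      simp [hx, hy, this]
    · have : x * y * w = z * (w * (x * y)) := by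
        rw [e1, hy, ← mul_assoc, hcx x w hx]; group
      simp [hx, hy, this, hz1]
  · have hy' := hcx y w hy
    by_cases hx : x * w = w * x
    · have : x * y * w = z * (w * (x * y)) := by
        rw [e1, hy', ← mul_assoc, h.zc, mul_assoc, ← mul_assoc x w, hx]; group
      simp [hx, hy, this, hz1]
    · have : x * y * w = w * (x * y) := by
        rw [e1, hy', ← mul_assoc, h.zc, mul_assoc, ← mul_assoc x w, hcx x w hx, ← mul_assoc,
          ← mul_assoc, h.z2]; group
      simp [hx, hy, this]

theorem sg_comm (x y : E) : sg x y = sg y x := by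
  unfold sg
  simp [eq_comm]

theorem sg_mul_right (h : ES E z) (x y w : E) : sg w (x * y) = sg w x * sg w y := by
  rw [sg_comm, sg_mul_left h, sg_comm x, sg_comm y]

theorem sg_eq_one {x y : E} : sg x y = 1 ↔ x * y = y * x := by
  unfold sg; split_ifs with hh <;> simp [hh]

theorem sg_sq (x y : E) : sg x y * sg x y = 1 := by
  unfold sg; split_ifs <;> simp

theorem sg_cases (x y : E) : sg x y = 1 ∨ sg x y = -1 := by
  unfold sg; split_ifs <;> simp

theorem eps_eq_one {x : E} : eps x = 1 ↔ x * x = 1 := by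
  unfold eps; split_ifs with hh <;> simp [hh]

theorem eps_cases (x : E) : eps x = 1 ∨ eps x = -1 := by
  unfold eps; split_ifs <;> simp

/-- sum over a subgroup -/
noncomputable def sumT (T : Subgroup E) (f : E → ℤ) : ℤ := ∑ x : T, f x

theorem sumT_mul (T : Subgroup E) (f : E → ℤ) (y : E) (hy : y ∈ T) :
    sumT T (fun x => f (x * y)) = sumT T f := by
  unfold sumT
  exact Equiv.sum_comp (Equiv.mulRight (⟨y, hy⟩ : T)) (fun x : T => f x)

theorem sum_sg (h : ES E z) (T : Subgroup E) (y t : E) (ht : t ∈ T) (hty : t * y ≠ y * t) :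
    sumT T (fun x => sg x y) = 0 := by
  have h1 := sumT_mul T (fun x => sg x y) t ht
  have h2 : sg t y = -1 := (sg_cases t y).resolve_left (fun h => hty (sg_eq_one.1 h))
  simp only [sg_mul_left h, h2] at h1
  unfold sumT at *
  rw [← Finset.sum_mul] at h1
  linarith

/-- intersect with the centralizer of an element -/
def cT (T : Subgroup E) (y : E) : Subgroup E := T ⊓ Subgroup.centralizer {y}

theorem mem_cT {T : Subgroup E} {x y : E} : x ∈ cT T y ↔ x ∈ T ∧ x * y = y * x := by
  unfold cT
  rw [Subgroup.mem_inf, Subgroup.mem_centralizer_singleton_iff]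

theorem sumT_eq (T : Subgroup E) (f : E → ℤ) :
    sumT T f = ∑ x ∈ Finset.univ.filter (fun x => x ∈ T), f x := by
  unfold sumT
  rw [Finset.sum_subtype _ (p := fun x => x ∈ T)]
  simp

theorem sumT_cT (T : Subgroup E) (y : E) (f : E → ℤ) :
    2 * sumT (cT T y) f = sumT T f + sumT T (fun x => f x * sg x y) := by
  rw [sumT_eq, sumT_eq, sumT_eq, ← Finset.sum_add_distrib, Finset.mul_sum]
  have : Finset.univ.filter (fun x => x ∈ cT T y) =
    (Finset.univ.filter (fun x => x ∈ T)).filter (fun x => x * y = y * x) := by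
    ext x; simp [mem_cT]
  rw [this, Finset.sum_filter]
  apply Finset.sum_congr rfl
  intro x _
  unfold sg
  split_ifs <;> ring

theorem card_sumT (T : Subgroup E) : (Nat.card T : ℤ) = sumT T (fun _ => 1) := by
  unfold sumT; simp

theorem card_cT (h : ES E z) (T : Subgroup E) (y t : E) (ht : t ∈ T) (hty : t * y ≠ y * t) :
    2 * Nat.card (cT T y) = Nat.card T := by
  have h1 := sumT_cT T y (fun _ => 1)
  simp only [one_mul] at h1
  rw [sum_sg h T y t ht hty, ← card_sumT, ← card_sumT] at h1
  omega

theorem eps_cT (h : ES E z) (T : Subgroup E) (y : E) (hy : y ∈ T) (hyy : y * y = 1) :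
    sumT (cT T y) eps = sumT T eps := by
  have h1 := sumT_cT T y eps
  have h2 := sumT_mul T eps y hy
  simp only [eps_mul h, eps_eq_one.2 hyy, mul_one] at h2
  rw [h2] at h1
  omega

theorem card_inv (T : Subgroup E) :
    2 * (Nat.card {x : E // x ∈ T ∧ x * x = 1} : ℤ) = Nat.card T + sumT T eps := by
  rw [card_sumT, sumT_eq, sumT_eq, ← Finset.sum_add_distrib, Nat.card_eq_fintype_card,
    Fintype.card_subtype]
  rw [← Finset.filter_filter, Finset.card_filter]
  push_cast
  rw [Finset.mul_sum]
  apply Finset.sum_congr rfl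
  intro x _
  unfold eps
  split_ifs <;> simp

theorem gauss (h : ES E z) : sumT (⊤ : Subgroup E) eps ^ 2 = 256 := by
  have e : ∀ f : E → ℤ, sumT (⊤ : Subgroup E) f = ∑ x, f x := by
    intro f; rw [sumT_eq]; simp
  have h0 : ∀ y : E, ∑ x, eps x * eps (x * y) = eps y * ∑ x, sg x y := by
    intro y
    rw [Finset.mul_sum]
    apply Finset.sum_congr rfl
    intro x _
    rw [eps_mul h]
    rcases eps_cases x with hx | hx <;> rw [hx] <;> ring
  have h1 : (∑ x : E, eps x) ^ 2 = ∑ y : E, eps y * ∑ x : E, sg x y := by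
    rw [sq, Finset.sum_mul_sum]
    simp_rw [← h0]
    rw [Finset.sum_comm (f := fun y x : E => eps x * eps (x * y))]
    apply Finset.sum_congr rfl
    intro x _
    exact (Equiv.sum_comp (Equiv.mulLeft x) (fun y => eps x * eps y)).symm
  have h2 : ∀ y, (∑ x, sg x y) = if y = 1 ∨ y = z then 128 else 0 := by
    intro y
    split_ifs with hy
    · have : ∀ x, sg x y = 1 := by
        intro x
        rw [sg_eq_one]
        rcases hy with rfl | rfl
        · simp
        · exact h.zc x
      simp [this, h.card]
    · have : ∃ t, t * y ≠ y * t := by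
        by_contra hne
        push Not at hne
        exact hy (h.cen y (fun t => (hne t).symm))
      obtain ⟨t, ht⟩ := this
      rw [← e]
      exact sum_sg h ⊤ y t trivial ht
  rw [e, h1]
  simp_rw [h2]
  have h3 : ∀ y : E, eps y * (if y = 1 ∨ y = z then 128 else 0) =
    (if y = 1 then 128 else 0) + (if y = z then (128 : ℤ) else 0) := by
    intro y
    have hz1 := h.z1
    by_cases hy : y = 1
    · subst hy; simp [eps, hz1.symm]
    · by_cases hy' : y = z
      · subst hy'; simp [eps, h.z2, hz1]
      · simp [hy, hy']
  simp_rw [h3]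
  rw [Finset.sum_add_distrib]
  simp

/-- double centralizer step -/
theorem dc (h : ES E z) (T : Subgroup E) (x y : E) (hx : ∀ t ∈ cT T y, t * x = x * t) :
    (∀ t ∈ T, t * x = x * t) ∨ (∀ t ∈ T, t * (x * y) = (x * y) * t) := by
  by_contra hcon
  push Not at hcon
  obtain ⟨⟨t, ht, htx⟩, ⟨u, hu, hux⟩⟩ := hcon
  have m : ∀ {a b : E}, a * b ≠ b * a → sg a b = -1 := fun {a b} hab =>
    (sg_cases a b).resolve_left (fun h => hab (sg_eq_one.1 h))
  have c1 := m htx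
  have c2 := m hux
  have c3 : sg t y = -1 := m (fun hc => htx (hx t (mem_cT.2 ⟨ht, hc⟩)))
  rw [sg_mul_right h] at c2
  rcases sg_cases u y with h4 | h4
  · rw [h4, sg_eq_one.2 (hx u (mem_cT.2 ⟨hu, sg_eq_one.1 h4⟩))] at c2
    norm_num at c2
  · rw [h4] at c2
    have c5 : sg u x = 1 := by linarith
    have c6 : sg (t * u) y = 1 := by rw [sg_mul_left h, c3, h4]; norm_num
    have c7 : sg (t * u) x = -1 := by rw [sg_mul_left h, c1, c5]; norm_num
    have := sg_eq_one.2 (hx (t * u) (mem_cT.2 ⟨mul_mem ht hu, sg_eq_one.1 c6⟩))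
    omega

theorem exists_outside (P : E → Prop) (F : Finset E) (hc : F.card < Nat.card {x : E // P x}) :
    ∃ x, P x ∧ x ∉ F := by
  by_contra hcon
  push Not at hcon
  have : Nat.card {x : E // P x} ≤ F.card := by
    rw [Nat.card_eq_fintype_card, Fintype.card_subtype]
    apply Finset.card_le_card
    intro x hx
    exact hcon x (Finset.mem_filter.1 hx).2
  omega

theorem cen1 (h : ES E z) {r x : E} (hx : ∀ t ∈ cT ⊤ r, t * x = x * t) :
    x ∈ ({1, z, r, z * r} : Finset E) ∨ x * r = 1 ∨ x * r = z := by
  rcases dc h ⊤ x r hx with h1 | h1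
  · left
    rcases h.cen x (fun y => (h1 y trivial).symm) with h2 | h2 <;> simp [h2]
  · right
    exact h.cen _ (fun y => (h1 y trivial).symm)

theorem cen1' (h : ES E z) {r x : E} (hr : r * r = 1) (hx : ∀ t ∈ cT ⊤ r, t * x = x * t) :
    x ∈ ({1, z, r, z * r} : Finset E) := by
  rcases cen1 h hx with h1 | h1 | h1
  · exact h1
  · have : x = r := by rw [← mul_one x, ← hr, ← mul_assoc, h1, one_mul]
    simp [this]
  · have : x = z * r := by rw [← mul_one x, ← hr, ← mul_assoc, h1]
    simp [this]

theorem noncentral (h : ES E z) {r : E} (h1 : r ≠ 1) (hz : r ≠ z) : ∃ t, t * r ≠ r * t := by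
  by_contra hne
  push Not at hne
  rcases h.cen r (fun t => (hne t).symm) with h2 | h2
  · exact h1 h2
  · exact hz h2

theorem card_C1 (h : ES E z) {r : E} (h1 : r ≠ 1) (hz : r ≠ z) :
    Nat.card (cT (⊤ : Subgroup E) r) = 64 := by
  obtain ⟨t, ht⟩ := noncentral h h1 hz
  have := card_cT h ⊤ r t trivial ht
  rw [Nat.card_congr Subgroup.topEquiv.toEquiv, Nat.card_eq_fintype_card (α := E), h.card] at this
  omega

theorem card4 (z r : E) : ({1, z, r, z * r} : Finset E).card ≤ 4 := Finset.card_le_four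

theorem step_a (h : ES E z) {r : E} (hr : r * r = 1)
    {a : E} (ha : a ∉ ({1, z, r, z * r} : Finset E)) :
    ∃ t ∈ cT ⊤ r, t * a ≠ a * t := by
  by_contra hne
  push Not at hne
  exact ha (cen1' h hr hne)

theorem S_eq (h : ES E z) {r : E} (hr : r * r = 1) (h1 : r ≠ 1) (hz : r ≠ z) :
    sumT (⊤ : Subgroup E) eps = -16 := by
  have hg := gauss h
  have h2 : sumT (⊤ : Subgroup E) eps = 16 ∨ sumT (⊤ : Subgroup E) eps = -16 := by
    have : (sumT (⊤ : Subgroup E) eps - 16) * (sumT (⊤ : Subgroup E) eps + 16) = 0 := by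
      nlinarith
    rcases mul_eq_zero.1 this with h3 | h3
    · left; linarith
    · right; linarith
  refine h2.resolve_left (fun hS => ?_)
  have e1 := eps_cT h ⊤ r trivial hr
  have c1 := card_C1 h h1 hz
  have n1 := card_inv (cT (⊤ : Subgroup E) r)
  rw [e1, hS, c1] at n1
  obtain ⟨a, ⟨ha1, ha2⟩, haF⟩ := exists_outside (fun x => x ∈ cT (⊤ : Subgroup E) r ∧ x * x = 1)
    {1, z, r, z * r} (lt_of_le_of_lt (card4 z r) (by omega))
  obtain ⟨t, ht, hta⟩ := step_a h hr haF
  have c2 := card_cT h _ a t ht hta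
  have e2 := eps_cT h _ a ha1 ha2
  have n2 := card_inv (cT (cT (⊤ : Subgroup E) r) a)
  rw [e2, e1, hS] at n2
  obtain ⟨b, ⟨hb1, hb2⟩, hbF⟩ := exists_outside
    (fun x => x ∈ cT (cT (⊤ : Subgroup E) r) a ∧ x * x = 1)
    ({1, z, r, z * r} ∪ ({1, z, r, z * r} : Finset E).image (fun x => x * a)) (by
      refine lt_of_le_of_lt (Finset.card_union_le _ _) ?_
      have := card4 z r
      have := (Finset.card_image_le (s := ({1, z, r, z * r} : Finset E)) (f := fun x => x * a))
      omega)
  have hb3 : ∃ t ∈ cT (cT (⊤ : Subgroup E) r) a, t * b ≠ b * t := by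
    by_contra hne
    push Not at hne
    apply hbF
    rw [Finset.mem_union]
    rcases dc h _ b a hne with h3 | h3
    · left; exact cen1' h hr h3
    · right
      rw [Finset.mem_image]
      exact ⟨b * a, cen1' h hr h3, by rw [mul_assoc, ha2, mul_one]⟩
  obtain ⟨u, hu, hub⟩ := hb3
  have c3 := card_cT h _ b u hu hub
  have e3 := eps_cT h _ b hb1 hb2
  have n3 := card_inv (cT (cT (cT (⊤ : Subgroup E) r) a) b)
  rw [e3, e2, e1, hS] at n3
  set A := cT (cT (cT (⊤ : Subgroup E) r) a) b
  have hA : ∀ x ∈ A, x * x = 1 := by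
    by_contra hne
    push Not at hne
    obtain ⟨x, hx, hxx⟩ := hne
    have : Nat.card {x : E // x ∈ A ∧ x * x = 1} < Nat.card A := by
      rw [Nat.card_eq_fintype_card, Nat.card_eq_fintype_card]
      refine Fintype.card_lt_of_injective_of_notMem
        (fun y : {x : E // x ∈ A ∧ x * x = 1} => (⟨y.1, y.2.1⟩ : A)) ?_ (b := ⟨x, hx⟩) ?_
      · intro y y' hy
        exact Subtype.ext (congrArg (fun w : A => (w : E)) hy)
      · rintro ⟨y, hy⟩
        have : y.1 = x := congrArg (fun w : A => (w : E)) hy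
        exact hxx (this ▸ y.2.2)
    omega
  have := h.min A hA
  omega

theorem count56 (h : ES E z) {r : E} (hr : r * r = 1) (h1 : r ≠ 1) (hz : r ≠ z) :
    Nat.card {x : E // x * x = 1} = 56 := by
  have n := card_inv (⊤ : Subgroup E)
  rw [S_eq h hr h1 hz, Nat.card_congr Subgroup.topEquiv.toEquiv, Nat.card_eq_fintype_card (α := E),
    h.card] at n
  have : Nat.card {x : E // x ∈ (⊤ : Subgroup E) ∧ x * x = 1} = Nat.card {x : E // x * x = 1} :=
    Nat.card_congr (Equiv.subtypeEquivRight (by simp))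
  omega

theorem count24 (h : ES E z) {r : E} (hr : r * r = 1) (h1 : r ≠ 1) (hz : r ≠ z) :
    Nat.card {x : E // x ∈ cT (⊤ : Subgroup E) r ∧ x * x = 1} = 24 := by
  have n := card_inv (cT (⊤ : Subgroup E) r)
  rw [eps_cT h ⊤ r trivial hr, S_eq h hr h1 hz, card_C1 h h1 hz] at n
  omega

theorem prodsing (h : ES E z) {r : E} (hr : r * r = 1) (h1 : r ≠ 1) (hz : r ≠ z)
    {y : E} (hy : y ∈ cT (⊤ : Subgroup E) r) (hyy : y * y = z) :
    ∃ x ∈ cT (⊤ : Subgroup E) r, x * x = 1 ∧ x * y ≠ y * x := by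
  by_contra hne
  push Not at hne
  have hyn : y ∉ ({1, z, r, z * r} : Finset E) := by
    have hz1 := h.z1
    intro hmem
    simp only [Finset.mem_insert, Finset.mem_singleton] at hmem
    have : y * y = 1 := by
      rcases hmem with rfl | rfl | rfl | rfl
      · simp
      · exact h.z2
      · exact hr
      · rw [mul_assoc, ← mul_assoc r, h.zc, mul_assoc, hr, mul_one, h.z2]
    exact hz1 (hyy ▸ this)
  obtain ⟨t, ht, hty⟩ := step_a h hr hyn
  have c2 := card_cT h _ y t ht hty
  rw [card_C1 h h1 hz] at c2
  have n2 := card_inv (cT (cT (⊤ : Subgroup E) r) y)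
  have hyT : y ∈ cT (cT (⊤ : Subgroup E) r) y := mem_cT.2 ⟨hy, rfl⟩
  have m := sumT_mul _ eps y hyT
  have hey : eps y = -1 := by
    unfold eps; rw [if_neg]; rw [hyy]; exact h.z1
  have : sumT (cT (cT (⊤ : Subgroup E) r) y) (fun x => eps (x * y)) =
      - sumT (cT (cT (⊤ : Subgroup E) r) y) eps := by
    unfold sumT
    rw [← Finset.sum_neg_distrib]
    apply Finset.sum_congr rfl
    intro x _
    show eps ((x : E) * y) = _
    rw [eps_mul h, hey, sg_eq_one.2 (mem_cT.1 x.2).2]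
    ring
  have e0 : sumT (cT (cT (⊤ : Subgroup E) r) y) eps = 0 := by linarith
  rw [e0] at n2
  have c24 := count24 h hr h1 hz
  have : Nat.card {x : E // x ∈ cT (⊤ : Subgroup E) r ∧ x * x = 1} =
      Nat.card {x : E // x ∈ cT (cT (⊤ : Subgroup E) r) y ∧ x * x = 1} := by
    apply Nat.card_congr (Equiv.subtypeEquivRight ?_)
    intro x
    constructor
    · rintro ⟨hx, hxx⟩
      exact ⟨mem_cT.2 ⟨hx, hne x hx hxx⟩, hxx⟩
    · rintro ⟨hx, hxx⟩
      exact ⟨(mem_cT.1 hx).1, hxx⟩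
  omega

theorem ES.ncm (h : ES E z) {x y : E} (hxy : x * y ≠ y * x) : x * y = z * (y * x) :=
  (h.cm x y).resolve_left hxy

theorem frame (h : ES E z) {r : E} (hr : r * r = 1) (h1 : r ≠ 1) (hz : r ≠ z) :
    ∃ a s i j : E, a * r = r * a ∧ s * r = r * s ∧ i * r = r * i ∧ j * r = r * j ∧
      a * a = 1 ∧ i * i = z ∧ j * j = z ∧ a * s = z * (s * a) ∧ i * j = z * (j * i) ∧
      i * a = a * i ∧ j * a = a * j ∧ i * s = s * i ∧ j * s = s * j ∧
      a ∉ ({1, z, r, z * r} : Finset E) := by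
  have e1 := eps_cT h ⊤ r trivial hr
  have c1 := card_C1 h h1 hz
  have n1 := card_inv (cT (⊤ : Subgroup E) r)
  have hS := S_eq h hr h1 hz
  rw [e1, hS, c1] at n1
  obtain ⟨a, ⟨ha1, ha2⟩, haF⟩ := exists_outside (fun x => x ∈ cT (⊤ : Subgroup E) r ∧ x * x = 1)
    {1, z, r, z * r} (lt_of_le_of_lt (card4 z r) (by omega))
  obtain ⟨t, ht, hta⟩ := step_a h hr haF
  have c2 := card_cT h _ a t ht hta
  have e2 := eps_cT h _ a ha1 ha2
  have n2 := card_inv (cT (cT (⊤ : Subgroup E) r) a)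
  rw [e2, e1, hS] at n2
  set T := cT (cT (⊤ : Subgroup E) r) a with hT
  -- an element of square `z`
  have hex : ∃ i ∈ T, i * i ≠ 1 := by
    by_contra hne
    push Not at hne
    have : Nat.card {x : E // x ∈ T ∧ x * x = 1} = Nat.card T := by
      apply Nat.card_congr (Equiv.subtypeEquivRight ?_)
      intro x
      exact ⟨fun hx => hx.1, fun hx => ⟨hx, hne x hx⟩⟩
    omega
  obtain ⟨i, hi, hii⟩ := hex
  have hii' : i * i = z := (h.sq i).resolve_left hii
  have hir := (mem_cT.1 (mem_cT.1 hi).1).2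
  have hia := (mem_cT.1 hi).2
  have har := (mem_cT.1 ha1).2
  -- `i` is not central in `T`
  have four : ∀ w ∈ ({1, z, r, z * r} : Finset E), w * w = 1 := by
    intro w hmem
    simp only [Finset.mem_insert, Finset.mem_singleton] at hmem
    rcases hmem with rfl | rfl | rfl | rfl
    · simp
    · exact h.z2
    · exact hr
    · rw [mul_assoc, ← mul_assoc r, h.zc, mul_assoc, hr, mul_one, h.z2]
  have hj : ∃ j ∈ T, j * i ≠ i * j := by
    by_contra hne
    push Not at hne
    rcases dc h _ i a hne with h3 | h3
    · exact hii (four _ (cen1' h hr h3))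
    · have := four _ (cen1' h hr h3)
      apply hii
      rw [← this, mul_assoc, ← mul_assoc a, ← hia, mul_assoc, ha2, mul_one]
  obtain ⟨j, hj, hji⟩ := hj
  have hjr := (mem_cT.1 (mem_cT.1 hj).1).2
  have hja := (mem_cT.1 hj).2
  have mone : ∀ {a b : E}, a * b ≠ b * a → sg a b = -1 := fun {a b} hab =>
    (sg_cases a b).resolve_left (fun h => hab (sg_eq_one.1 h))
  have sji := mone hji
  have sij := mone hji.symm
  have sii : sg i i = 1 := sg_eq_one.2 rfl
  have sjj : sg j j = 1 := sg_eq_one.2 rfl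
  have hjj : j * j = z := by
    refine (h.sq j).resolve_left (fun hjj => ?_)
    -- otherwise all elements of `T` of square one exceed 8
    have e3 := eps_cT h T j hj hjj
    have c3 := card_cT h T j i hi hji.symm
    have n3 := card_inv (cT T j)
    rw [e3, e2, e1, hS] at n3
    have : 0 < Nat.card {x : E // x ∈ cT T j ∧ x * x = 1} := by
      have : Nonempty {x : E // x ∈ cT T j ∧ x * x = 1} := ⟨⟨1, one_mem _, by simp⟩⟩
      exact Nat.card_pos
    omega
  -- now `s`
  have htr := (mem_cT.1 ht).2
  have sta := mone hta
  obtain ⟨s, hs1, hs2, hs3, hs4⟩ : ∃ s : E, sg s r = 1 ∧ sg s a = -1 ∧ sg s i = 1 ∧ sg s j = 1 := by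
    have i1 := sg_eq_one.2 hir
    have j1 := sg_eq_one.2 hjr
    have i2 := sg_eq_one.2 hia
    have j2 := sg_eq_one.2 hja
    have t1 := sg_eq_one.2 htr
    rcases sg_cases t i with h3 | h3 <;> rcases sg_cases t j with h4 | h4
    · exact ⟨t, t1, sta, h3, h4⟩
    · refine ⟨t * i, ?_, ?_, ?_, ?_⟩ <;> simp [sg_mul_left h, *]
    · refine ⟨t * j, ?_, ?_, ?_, ?_⟩ <;> simp [sg_mul_left h, *]
    · refine ⟨t * i * j, ?_, ?_, ?_, ?_⟩ <;> simp [sg_mul_left h, *]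
  refine ⟨a, s, i, j, har, sg_eq_one.1 hs1, hir, hjr, ha2, hii', hjj, h.ncm ?_, h.ncm hji.symm,
    hia, hja, (sg_eq_one.1 hs3).symm, (sg_eq_one.1 hs4).symm, haF⟩
  intro hc
  rw [sg_eq_one.2 hc.symm] at hs2
  norm_num at hs2

end ES

section LA
set_option linter.unusedSectionVars false

theorem eq_zero_of_neg {V : Type*} [AddCommGroup V] [Module (ZMod 3) V] {v : V} (h : v = -v) :
    v = 0 := by
  have h2 : (2 : ZMod 3) • v = 0 := by
    rw [two_smul]; nth_rewrite 2 [h]; simp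
  rcases smul_eq_zero.1 h2 with h3 | h3
  · exact absurd h3 (by decide)
  · exact h3

theorem neg_two {V : Type*} [AddCommGroup V] [Module (ZMod 3) V] (v : V) : -(v + v) = v := by
  have h2 : (3 : ZMod 3) • v = 0 := by
    rw [show (3 : ZMod 3) = 0 from by decide, zero_smul]
  have h3 : (3 : ZMod 3) • v = v + v + v := by
    rw [show (3 : ZMod 3) = 1 + 1 + 1 from by decide, add_smul, add_smul, one_smul]
  rw [h3] at h2
  rw [neg_eq_iff_add_eq_zero]; exact h2

variable {V : Type*} [AddCommGroup V] [Module (ZMod 3) V] [FiniteDimensional (ZMod 3) V]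

open Module

theorem eig_split (W : Submodule (ZMod 3) V) (f s : Module.End (ZMod 3) V)
    (hfW : ∀ w ∈ W, f w ∈ W) (hf : ∀ w ∈ W, f (f w) = w) (hsW : ∀ w ∈ W, s w ∈ W)
    (hs : Function.Injective s) (hsf : ∀ w ∈ W, f (s w) = -(s (f w))) :
    finrank (ZMod 3) W = 2 * finrank (ZMod 3) (W ⊓ LinearMap.ker (f - 1) : Submodule (ZMod 3) V) := by
  set A := W ⊓ LinearMap.ker (f - 1) with hA
  set B := W ⊓ LinearMap.ker (f + 1) with hB
  have mA : ∀ w, w ∈ A ↔ w ∈ W ∧ f w = w := by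
    intro w; simp [hA, sub_eq_zero]
  have mB : ∀ w, w ∈ B ↔ w ∈ W ∧ f w = -w := by
    intro w; simp [hB, add_eq_zero_iff_eq_neg]
  have h1 : A.map s ≤ B := by
    rintro _ ⟨w, hw, rfl⟩
    have := (mA w).1 hw
    exact (mB _).2 ⟨hsW w this.1, by rw [hsf w this.1, this.2]⟩
  have h2 : B.map s ≤ A := by
    rintro _ ⟨w, hw, rfl⟩
    have := (mB w).1 hw
    exact (mA _).2 ⟨hsW w this.1, by rw [hsf w this.1, this.2]; simp⟩
  have h3 := Submodule.finrank_mono h1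
  have h4 := Submodule.finrank_mono h2
  rw [← (Submodule.equivMapOfInjective s hs A).finrank_eq] at h3
  rw [← (Submodule.equivMapOfInjective s hs B).finrank_eq] at h4
  have hsup : A ⊔ B = W := by
    apply le_antisymm (sup_le inf_le_left inf_le_left)
    intro w hw
    have : w = -(w + f w) + (-(w - f w)) := by
      have := neg_two w
      rw [← neg_add]; nth_rewrite 1 [← this]; congr 1; abel
    rw [this]
    have hfw := hfW w hw
    apply Submodule.add_mem_sup
    · rw [mA]; refine ⟨W.neg_mem (W.add_mem hw hfw), ?_⟩
      rw [map_neg, map_add, hf w hw, add_comm]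
    · rw [mB]; refine ⟨W.neg_mem (W.sub_mem hw hfw), ?_⟩
      rw [map_neg, map_sub, hf w hw]; abel
  have hinf : A ⊓ B = ⊥ := by
    rw [eq_bot_iff]
    intro w hw
    have e1 := ((mA w).1 hw.1).2
    have e2 := ((mB w).1 hw.2).2
    exact (Submodule.mem_bot _).2 (eq_zero_of_neg (e1.symm.trans e2))
  have := Submodule.finrank_sup_add_finrank_inf_eq A B
  rw [hsup, hinf, finrank_bot] at this
  omega

theorem indep_pair (i : Module.End (ZMod 3) V) (v : V) (hv : v ≠ 0) (hi : i (i v) = -v) :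
    LinearIndependent (ZMod 3) ![v, i v] := by
  rw [LinearIndependent.pair_iff' hv]
  intro c hc
  have h1 : i (i v) = (c * c) • v := by
    rw [← hc, map_smul, ← hc, smul_smul]
  rw [h1] at hi
  have h2 : (c * c + 1) • v = 0 := by
    rw [add_smul, one_smul, hi]; simp
  rcases smul_eq_zero.1 h2 with h3 | h3
  · exact absurd h3 ((by decide : ∀ c : ZMod 3, c * c + 1 ≠ 0) c)
  · exact hv h3

/-- The data of the frame as acting on `V`. -/
structure Fr (G : Type*) [Group G] (z r a s i j s0 : G) : Prop where
  zr : r * z = z * r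
  za : a * z = z * a
  zs : s * z = z * s
  zi : i * z = z * i
  zj : j * z = z * j
  zs0 : s0 * z = z * s0
  zz : z * z = 1
  rr : r * r = 1
  ra : a * r = r * a
  rs : s * r = r * s
  ri : i * r = r * i
  rj : j * r = r * j
  rs0 : r * s0 = z * (s0 * r)
  aa : a * a = 1
  ii : i * i = z
  jj : j * j = z
  as : a * s = z * (s * a)
  ij : i * j = z * (j * i)
  ia : i * a = a * i
  ja : j * a = a * j
  is : i * s = s * i
  js : j * s = s * j

variable {G : Type*} [Group G] (ρ : G →* Module.End (ZMod 3) V)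

theorem rho_inj (g : G) : Function.Injective (ρ g) := by
  intro x y h
  have := congrArg (ρ g⁻¹) h
  rwa [← Module.End.mul_apply, ← Module.End.mul_apply, ← map_mul, inv_mul_cancel, map_one] at this

theorem rho_mul (g h : G) (v : V) : ρ (g * h) v = ρ g (ρ h v) := by
  rw [map_mul]; rfl

/-- vectors with `z = -1`, `r = 1` -/
theorem finrank_chain {z r a s i j s0 : G} (F : Fr G z r a s i j s0)
    (hz : ρ z ≠ 1) (hV : finrank (ZMod 3) V = 8) :
    (∀ v, ρ z v = -v) ∧ finrank (ZMod 3) (LinearMap.ker (ρ r - 1) ⊓ LinearMap.ker (ρ a - 1) :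
      Submodule (ZMod 3) V) = 2 := by
  have com : ∀ {g h : G}, g * h = h * g → ∀ v, ρ g (ρ h v) = ρ h (ρ g v) := by
    intro g h hgh v; rw [← rho_mul, ← rho_mul, hgh]
  set W := LinearMap.ker (ρ z + 1) with hW
  have mW : ∀ w, w ∈ W ↔ ρ z w = -w := by
    intro w; simp [hW, add_eq_zero_iff_eq_neg]
  have zinv : ∀ v, ρ z (ρ z v) = v := by
    intro v; rw [← rho_mul, F.zz, map_one]; rfl
  have pres : ∀ {g : G}, g * z = z * g → ∀ w ∈ W, ρ g w ∈ W := by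
    intro g hg w hw
    rw [mW] at hw ⊢
    rw [← com hg, hw, map_neg]
  have i1 := eig_split W (ρ r) (ρ s0) (pres F.zr)
    (by intro w _; rw [← rho_mul, F.rr, map_one]; rfl) (pres F.zs0) (rho_inj ρ s0)
    (by intro w hw
        rw [← rho_mul, F.rs0, rho_mul, rho_mul ρ s0]
        exact (mW _).1 (pres F.zs0 _ (pres F.zr _ hw)))
  set W1 := W ⊓ LinearMap.ker (ρ r - 1) with hW1
  have mW1 : ∀ w, w ∈ W1 ↔ w ∈ W ∧ ρ r w = w := by
    intro w; simp [hW1, sub_eq_zero]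
  have pres1 : ∀ {g : G}, g * z = z * g → g * r = r * g → ∀ w ∈ W1, ρ g w ∈ W1 := by
    intro g hg hg' w hw
    rw [mW1] at hw ⊢
    exact ⟨pres hg w hw.1, by rw [← com hg', hw.2]⟩
  have i2 := eig_split W1 (ρ a) (ρ s) (pres1 F.za F.ra)
    (by intro w _; rw [← rho_mul, F.aa, map_one]; rfl) (pres1 F.zs F.rs) (rho_inj ρ s)
    (by intro w hw
        rw [← rho_mul, F.as, rho_mul, rho_mul ρ s]
        exact (mW _).1 ((mW1 _).1 (pres1 F.zs F.rs _ (pres1 F.za F.ra _ hw))).1)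
  set W2 := W1 ⊓ LinearMap.ker (ρ a - 1) with hW2
  have mW2 : ∀ w, w ∈ W2 ↔ w ∈ W1 ∧ ρ a w = w := by
    intro w; simp [hW2, sub_eq_zero]
  have hWne : W ≠ ⊥ := by
    intro hbot
    apply hz
    ext v
    have : ρ z v - v ∈ W := by
      rw [mW, map_sub, zinv]; abel
    rw [hbot, Submodule.mem_bot, sub_eq_zero] at this
    exact this
  have hW2ne : W2 ≠ ⊥ := by
    intro hbot
    apply hWne
    rw [← Submodule.finrank_eq_zero (R := ZMod 3)]
    rw [hbot, finrank_bot] at i2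
    omega
  obtain ⟨v, hv, hv0⟩ := Submodule.exists_mem_ne_zero_of_ne_bot hW2ne
  have hvW := ((mW1 v).1 ((mW2 v).1 hv).1).1
  have hi : ρ i (ρ i v) = -v := by
    rw [← rho_mul, F.ii]; exact (mW v).1 hvW
  have hiv : ρ i v ∈ W2 := by
    rw [mW2]
    exact ⟨pres1 F.zi F.ri v ((mW2 v).1 hv).1, by rw [← com F.ia, ((mW2 v).1 hv).2]⟩
  have hli := indep_pair (ρ i) v hv0 hi
  have h2 : 2 ≤ finrank (ZMod 3) W2 := by
    have hsp := finrank_span_eq_card hli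
    have hle : Submodule.span (ZMod 3) (Set.range ![v, ρ i v]) ≤ W2 := by
      rw [Submodule.span_le]
      rintro _ ⟨k, rfl⟩
      fin_cases k
      · exact hv
      · exact hiv
    have := Submodule.finrank_mono hle
    rw [hsp] at this
    simpa using this
  have hle := Submodule.finrank_le W
  have hWtop : W = ⊤ := Submodule.eq_top_of_finrank_eq (by omega)
  refine ⟨fun v => (mW v).1 (hWtop ▸ Submodule.mem_top), ?_⟩
  have : W2 = LinearMap.ker (ρ r - 1) ⊓ LinearMap.ker (ρ a - 1) := by
    rw [hW2, hW1, hWtop, top_inf_eq]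
  rw [← this]
  omega

theorem schur {z r a s i j s0 : G} (F : Fr G z r a s i j s0)
    (hz : ρ z ≠ 1) (hV : finrank (ZMod 3) V = 8) (p : Module.End (ZMod 3) V)
    (hp : Function.Injective p)
    (pr : ∀ v, ρ r v = v → ρ r (p v) = p v)
    (pa : ∀ v, ρ r v = v → ρ a (p v) = p (ρ a v))
    (ps : ∀ v, ρ r v = v → ρ s (p v) = p (ρ s v))
    (pi : ∀ v, ρ r v = v → ρ i (p v) = p (ρ i v))
    (pj : ∀ v, ρ r v = v → ρ j (p v) = p (ρ j v)) :
    (∀ v, ρ r v = v → p v = v) ∨ (∀ v, ρ r v = v → p v = ρ z v) := by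
  obtain ⟨hneg, hfr⟩ := finrank_chain ρ F hz hV
  have com : ∀ {g h : G}, g * h = h * g → ∀ v, ρ g (ρ h v) = ρ h (ρ g v) := by
    intro g h hgh v; rw [← rho_mul, ← rho_mul, hgh]
  set B := LinearMap.ker (ρ r - 1) ⊓ LinearMap.ker (ρ a - 1) with hB
  have mB : ∀ w, w ∈ B ↔ ρ r w = w ∧ ρ a w = w := by
    intro w; simp [hB, sub_eq_zero]
  have hBne : B ≠ ⊥ := by
    intro hbot
    rw [hbot, finrank_bot] at hfr
    omega
  obtain ⟨v, hv, hv0⟩ := Submodule.exists_mem_ne_zero_of_ne_bot hBne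
  have presB : ∀ {g : G}, g * r = r * g → g * a = a * g → ∀ w ∈ B, ρ g w ∈ B := by
    intro g h1 h2 w hw
    rw [mB] at hw ⊢
    exact ⟨by rw [← com h1, hw.1], by rw [← com h2, hw.2]⟩
  have presp : ∀ w ∈ B, p w ∈ B := by
    intro w hw
    rw [mB] at hw ⊢
    exact ⟨pr w hw.1, by rw [pa w hw.1, hw.2]⟩
  have hi : ∀ w, ρ i (ρ i w) = -w := by
    intro w; rw [← rho_mul, F.ii, hneg]
  have hli := indep_pair (ρ i) v hv0 (hi v)
  have hiv := presB F.ri F.ia v hv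
  have hspan : Submodule.span (ZMod 3) (Set.range ![v, ρ i v]) = B := by
    apply Submodule.eq_of_le_of_finrank_eq
    · rw [Submodule.span_le]
      rintro _ ⟨k, rfl⟩
      fin_cases k
      · exact hv
      · exact hiv
    · rw [finrank_span_eq_card hli, hfr]; simp
  have hcomb : ∀ w ∈ B, ∃ α β : ZMod 3, α • v + β • ρ i v = w := by
    intro w hw
    rw [← hspan] at hw
    have : Set.range ![v, ρ i v] = {v, ρ i v} := by
      simp [Matrix.range_cons, Matrix.range_empty, Set.pair_comm]
    rw [this] at hw
    exact Submodule.mem_span_pair.1 hw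
  obtain ⟨α, β, hαβ⟩ := hcomb (p v) (presp v hv)
  have hjv := presB F.rj F.ja v hv
  obtain ⟨γ, δ, hγδ⟩ := hcomb (ρ j v) hjv
  have rv := ((mB v).1 hv).1
  -- compute `p (j v)` in two ways
  have e1 : p (ρ j v) = α • ρ j v + β • ρ j (ρ i v) := by
    rw [← pj v rv, ← hαβ, map_add, map_smul, map_smul]
  have e2 : p (ρ j v) = α • ρ j v + β • ρ i (ρ j v) := by
    conv_lhs => rw [← hγδ, map_add, map_smul, map_smul, ← pi v rv, ← hαβ]
    conv_rhs => rw [← hγδ]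
    simp only [map_add, map_smul, hi, smul_add, smul_smul, smul_neg, mul_comm]
    abel
  have e3 : ρ i (ρ j v) = - ρ j (ρ i v) := by
    rw [← rho_mul, F.ij, rho_mul, hneg, rho_mul]
  have e4 : β • ρ j (ρ i v) = 0 := by
    apply eq_zero_of_neg
    have := e1.symm.trans e2
    rw [e3, smul_neg] at this
    exact add_left_cancel this
  have hβ : β = 0 := by
    rcases smul_eq_zero.1 e4 with h | h
    · exact h
    · exfalso
      apply hv0
      apply rho_inj ρ i
      apply rho_inj ρ j
      rw [h, map_zero, map_zero]
  rw [hβ, zero_smul, add_zero] at hαβ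
  have hα : α ≠ 0 := by
    rintro rfl
    rw [zero_smul] at hαβ
    exact hv0 (hp (by rw [map_zero, hαβ]))
  have hBα : ∀ w ∈ B, p w = α • w := by
    intro w hw
    obtain ⟨x, y, rfl⟩ := hcomb w hw
    rw [map_add, map_smul, map_smul, ← pi v rv, ← hαβ, map_smul, smul_add, smul_comm α x,
      smul_comm α y]
  have aa : ∀ u, ρ a (ρ a u) = u := by
    intro u; rw [← rho_mul, F.aa, map_one]; rfl
  have hall : ∀ w, ρ r w = w → p w = α • w := by
    intro w hw
    have hraw : ρ r (ρ a w) = ρ a w := by rw [← com F.ra, hw]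
    have k1 : w + ρ a w ∈ B := by
      rw [mB]; refine ⟨by rw [map_add, hw, hraw], by rw [map_add, aa, add_comm]⟩
    have k2 : ρ s (w - ρ a w) ∈ B := by
      rw [mB]; refine ⟨by rw [← com F.rs, map_sub, hw, hraw], ?_⟩
      rw [← rho_mul, F.as, rho_mul, rho_mul, hneg, map_sub (ρ a), aa]
      rw [← map_neg]; congr 1; abel
    have q1 := hBα _ k1
    have q2 := hBα _ k2
    rw [← ps _ (by rw [map_sub, hw, hraw]), ← map_smul] at q2
    have q3 := rho_inj ρ s q2
    have : w = -((w + ρ a w) + (w - ρ a w)) := by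
      nth_rewrite 1 [← neg_two w]; congr 1; abel
    rw [this, map_neg, map_add, q1, q3, smul_neg, smul_add α (w + ρ a w)]
  have : α = 1 ∨ α = -1 := (by decide : ∀ c : ZMod 3, c ≠ 0 → c = 1 ∨ c = -1) α hα
  rcases this with rfl | rfl
  · left; intro w hw; rw [hall w hw, one_smul]
  · right; intro w hw; rw [hall w hw, hneg, neg_smul, one_smul]

end LA

section SP
open Matrix

abbrev M2 := Matrix (Fin 2) (Fin 2) (ZMod 3)

theorem nU_mem (S : M2) (hS : Sᵀ = S) :
    fromBlocks 1 S 0 1 ∈ Matrix.symplecticGroup (Fin 2) (ZMod 3) := by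
  rw [SymplecticGroup.mem_iff, J, fromBlocks_transpose, fromBlocks_multiply, fromBlocks_multiply]
  simp [hS]

theorem nL_mem (S : M2) (hS : Sᵀ = S) :
    fromBlocks 1 0 S 1 ∈ Matrix.symplecticGroup (Fin 2) (ZMod 3) := by
  rw [SymplecticGroup.mem_iff, J, fromBlocks_transpose, fromBlocks_multiply, fromBlocks_multiply]
  simp [hS]

theorem mA_mem (A B : M2) (h : A * B = 1) :
    fromBlocks A 0 0 Bᵀ ∈ Matrix.symplecticGroup (Fin 2) (ZMod 3) := by
  rw [SymplecticGroup.mem_iff, J, fromBlocks_transpose, fromBlocks_multiply, fromBlocks_multiply]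
  have h' : Bᵀ * Aᵀ = 1 := by rw [← transpose_mul, h, transpose_one]
  simp [h, h']

def symM (t : Fin 3 → ZMod 3) : M2 := !![t 0, t 1; t 1, t 2]

theorem symM_symm (t : Fin 3 → ZMod 3) : (symM t)ᵀ = symM t := by
  ext i j; fin_cases i <;> fin_cases j <;> rfl

theorem symM_inj : Function.Injective symM := by
  intro t u h
  ext k
  fin_cases k
  · simpa [symM] using congrFun (congrFun h 0) 0
  · simpa [symM] using congrFun (congrFun h 0) 1
  · simpa [symM] using congrFun (congrFun h 1) 1

noncomputable def bigCell (x : GL (Fin 2) (ZMod 3) × (Fin 3 → ZMod 3) × (Fin 3 → ZMod 3)) : Sp43 :=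
  ⟨_, nL_mem _ (symM_symm x.2.1)⟩ * ⟨_, mA_mem x.1.1 (x.1⁻¹).1 (by simp)⟩ *
    ⟨_, nU_mem _ (symM_symm x.2.2)⟩

theorem bigCell_inj : Function.Injective bigCell := by
  rintro ⟨A, S, T⟩ ⟨A', S', T'⟩ h
  have h1 : (bigCell (A, S, T)).1 = (bigCell (A', S', T')).1 := congrArg Subtype.val h
  simp only [bigCell, Submonoid.coe_mul, fromBlocks_multiply] at h1
  simp only [mul_one, one_mul, mul_zero, zero_mul, add_zero, zero_add, fromBlocks_inj] at h1
  obtain ⟨e1, e2, e3, -⟩ := h1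
  have hA : A = A' := Units.ext e1
  subst hA
  have hS : symM S = symM S' := by
    have := congrArg (fun X => X * (A⁻¹).1) e3
    simpa [mul_assoc] using this
  have hT : symM T = symM T' := by
    have := congrArg (fun X => (A⁻¹).1 * X) e2
    simpa [← mul_assoc] using this
  rw [symM_inj hS, symM_inj hT]

theorem card_Sp43_ge : 34992 ≤ Nat.card Sp43 := by
  have h := Nat.card_le_card_of_injective _ bigCell_inj
  have hGL : Nat.card (GL (Fin 2) (ZMod 3)) = 48 := by
    rw [Matrix.card_GL_field]
    simp [Fin.prod_univ_two, ZMod.card]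
  have e : Nat.card (GL (Fin 2) (ZMod 3) × (Fin 3 → ZMod 3) × (Fin 3 → ZMod 3)) = 34992 := by
    rw [Nat.card_prod, Nat.card_prod, hGL]
    simp
  omega

theorem center_scalar (M : Sp43) (hM : M ∈ Subgroup.center Sp43) :
    ∃ c : ZMod 3, c ≠ 0 ∧ M.1 = fromBlocks (c • (1 : M2)) 0 0 (c • (1 : M2)) := by
  rw [Subgroup.mem_center_iff] at hM
  obtain ⟨A, B, C, D, hABCD⟩ : ∃ A B C D, M.1 = fromBlocks A B C D :=
    ⟨_, _, _, _, (fromBlocks_toBlocks M.1).symm⟩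
  have hU : ∀ S : M2, Sᵀ = S → S * C = 0 ∧ B + S * D = A * S + B := by
    intro S hS
    have := congrArg Subtype.val (hM ⟨_, nU_mem S hS⟩)
    simp only [Submonoid.coe_mul, hABCD, fromBlocks_multiply] at this
    simp only [mul_one, one_mul, mul_zero, zero_mul, add_zero, zero_add, fromBlocks_inj] at this
    exact ⟨by simpa using this.1, this.2.1⟩
  have hL : B = 0 := by
    have := congrArg Subtype.val (hM ⟨_, nL_mem 1 (by simp)⟩)
    simp only [Submonoid.coe_mul, hABCD, fromBlocks_multiply] at this
    simp only [mul_one, one_mul, mul_zero, zero_mul, add_zero, zero_add, fromBlocks_inj] at this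
    simpa using this.1
  have hC : C = 0 := by simpa using (hU 1 (by simp)).1
  have hD : D = A := by simpa [hL] using (hU 1 (by simp)).2
  subst hL hC hD
  have k1 := (hU !![1, 0; 0, 0] (by ext i j; fin_cases i <;> fin_cases j <;> rfl)).2
  have k2 := (hU !![0, 1; 1, 0] (by ext i j; fin_cases i <;> fin_cases j <;> rfl)).2
  have f1 := congrFun (congrFun k1 0) 1
  have f2 := congrFun (congrFun k1 1) 0
  have f3 := congrFun (congrFun k2 0) 1
  rw [Matrix.add_apply, Matrix.add_apply, Matrix.mul_apply, Matrix.mul_apply] at f1 f2 f3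
  simp [Fin.sum_univ_two] at f1 f2 f3
  have hDs : D = D 0 0 • (1 : M2) := by
    ext i j; fin_cases i <;> fin_cases j <;> simp [f1, f2.symm, f3]
  refine ⟨D 0 0, ?_, ?_⟩
  · intro h0
    rw [h0, zero_smul] at hDs
    have hm := M.2
    rw [hABCD, hDs, SymplecticGroup.mem_iff] at hm
    simp only [fromBlocks_zero, zero_mul] at hm
    have := congrFun (congrFun hm (Sum.inr 0)) (Sum.inl 0)
    simp [J] at this
  · rw [hABCD, ← hDs]

theorem card_center_le : Nat.card (Subgroup.center Sp43) ≤ 2 := by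
  choose f hf using fun M : Subgroup.center Sp43 => center_scalar M.1 M.2
  have : Function.Injective (fun M => (⟨f M, (hf M).1⟩ : {c : ZMod 3 // c ≠ 0})) := by
    intro M N h
    have h' : f M = f N := congrArg Subtype.val h
    apply Subtype.ext
    apply Subtype.ext
    rw [(hf M).2, (hf N).2, h']
  have := Nat.card_le_card_of_injective _ this
  rw [Nat.card_eq_fintype_card (α := {c : ZMod 3 // c ≠ 0})] at this
  have e : Fintype.card {c : ZMod 3 // c ≠ 0} = 2 := by decide
  omega

theorem card_PSp43_ge : 17496 ≤ Nat.card PSp43 := by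
  show 17496 ≤ Nat.card (Sp43 ⧸ Subgroup.center Sp43)
  have h1 := Subgroup.card_eq_card_quotient_mul_card_subgroup (Subgroup.center Sp43)
  have h2 := card_Sp43_ge
  have h3 := card_center_le
  rw [h1] at h2
  by_contra hlt
  push Not at hlt
  have : Nat.card (Sp43 ⧸ Subgroup.center Sp43) * Nat.card (Subgroup.center Sp43) ≤ 17495 * 2 :=
    Nat.mul_le_mul (by omega) h3
  omega
end SP

section TA
open Module
set_option linter.unusedSectionVars false

structure Ctx {G V : Type*} [Group G] [Finite G] [AddCommGroup V] [Module (ZMod 3) V]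
    (R : Subgroup G) (ρ : G →* Module.End (ZMod 3) V) (z r a s i j s0 : G) : Prop where
  fr : Fr G z r a s i j s0
  hz : z ∈ R
  hr : r ∈ R
  ha : a ∈ R
  hs : s ∈ R
  hi : i ∈ R
  hj : j ∈ R
  Rn : R.Normal
  z1 : z ≠ 1
  r1 : r ≠ 1
  rz : r ≠ z
  zcen : ∀ g, g * z = z * g
  sq : ∀ x ∈ R, x * x = 1 ∨ x * x = z
  cm : ∀ x ∈ R, ∀ y ∈ R, x * y = y * x ∨ x * y = z * (y * x)
  cenC : ∀ x ∈ R, (∀ t ∈ R, t * r = r * t → t * x = x * t) → x = 1 ∨ x = z ∨ x = r ∨ x = z * r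
  cardC : Nat.card (R ⊓ Subgroup.centralizer {r} : Subgroup G) = 64
  prods : ∀ y ∈ R, y * r = r * y → y * y = z → ∃ x ∈ R, x * r = r * x ∧ x * x = 1 ∧ x * y ≠ y * x
  c24 : Nat.card {x : G // x ∈ R ⊓ Subgroup.centralizer {r} ∧ x * x = 1} = 24
  cardD : 41472 ≤ Nat.card (Subgroup.centralizer ({r} : Set G))
  inj : Function.Injective ρ
  fd : finrank (ZMod 3) V = 8
  mini : ∀ A : Subgroup G, A ≤ R → (∀ x ∈ A, x * x = 1) → Nat.card A ≤ 8
  aN : a ≠ 1 ∧ a ≠ z ∧ a ≠ r ∧ a ≠ z * r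

variable {G V : Type*} [Group G] [Finite G] [AddCommGroup V] [Module (ZMod 3) V]
  [FiniteDimensional (ZMod 3) V]
  {R : Subgroup G} {ρ : G →* Module.End (ZMod 3) V} {z r a s i j s0 : G}

theorem memCent {r x : G} : x ∈ Subgroup.centralizer ({r} : Set G) ↔ x * r = r * x := by
  rw [Subgroup.mem_centralizer_singleton_iff]

namespace Ctx

theorem comm_zr (h : Ctx R ρ z r a s i j s0) (g : G) : g * (z * r) = (z * r) * g ↔ g * r = r * g := by
  rw [← mul_assoc, h.zcen, mul_assoc, mul_assoc]
  exact mul_right_inj z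

theorem cent_zr (h : Ctx R ρ z r a s i j s0) :
    Subgroup.centralizer ({z * r} : Set G) = Subgroup.centralizer {r} := by
  ext g; rw [memCent, memCent, h.comm_zr]

theorem zzr (h : Ctx R ρ z r a s i j s0) : z * (z * r) = r := by
  rw [← mul_assoc, h.fr.zz, one_mul]

theorem swap (h : Ctx R ρ z r a s i j s0) : Ctx R ρ z (z * r) a s i j s0 where
  fr := { h.fr with
    zr := h.zcen _
    rr := by rw [mul_assoc, ← mul_assoc r, h.zcen, mul_assoc, h.fr.rr, mul_one, h.fr.zz]
    ra := (h.comm_zr _).2 h.fr.ra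
    rs := (h.comm_zr _).2 h.fr.rs
    ri := (h.comm_zr _).2 h.fr.ri
    rj := (h.comm_zr _).2 h.fr.rj
    rs0 := by
      rw [mul_assoc, h.fr.rs0, ← mul_assoc s0, h.zcen s0]; simp only [mul_assoc] }
  hz := h.hz
  hr := mul_mem h.hz h.hr
  ha := h.ha
  hs := h.hs
  hi := h.hi
  hj := h.hj
  Rn := h.Rn
  z1 := h.z1
  r1 := by
    intro e; apply h.rz; rw [← h.zzr, e, mul_one]
  rz := by
    intro e; exact h.r1 (mul_eq_left.1 e)
  zcen := h.zcen
  sq := h.sq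
  cm := h.cm
  cenC := by
    intro x hx hh
    rw [h.zzr]
    have := h.cenC x hx (fun t ht htr => hh t ht ((h.comm_zr t).2 htr))
    tauto
  cardC := by rw [h.cent_zr]; exact h.cardC
  prods := by
    intro y hy hyr hyy
    obtain ⟨x, h1, h2, h3⟩ := h.prods y hy ((h.comm_zr y).1 hyr) hyy
    exact ⟨x, h1, (h.comm_zr x).2 h2, h3⟩
  c24 := by rw [h.cent_zr]; exact h.c24
  cardD := by rw [h.cent_zr]; exact h.cardD
  inj := h.inj
  fd := h.fd
  mini := h.mini
  aN := by rw [h.zzr]; have := h.aN; tauto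

theorem hz' (h : Ctx R ρ z r a s i j s0) : ρ z ≠ 1 := by
  intro e
  exact h.z1 (h.inj (e.trans (map_one ρ).symm))

theorem neg (h : Ctx R ρ z r a s i j s0) (v : V) : ρ z v = -v :=
  (finrank_chain ρ h.fr h.hz' h.fd).1 v

theorem Une (h : Ctx R ρ z r a s i j s0) : ∃ v, ρ r v = v ∧ v ≠ 0 := by
  have h2 := (finrank_chain ρ h.fr h.hz' h.fd).2
  have hB : LinearMap.ker (ρ r - 1) ⊓ LinearMap.ker (ρ a - 1) ≠ ⊥ := by
    intro hbot
    rw [hbot, finrank_bot] at h2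
    omega
  obtain ⟨v, hv, hv0⟩ := Submodule.exists_mem_ne_zero_of_ne_bot hB
  refine ⟨v, ?_, hv0⟩
  have := hv.1
  simpa [sub_eq_zero] using this

theorem comr (_h : Ctx R ρ z r a s i j s0) {g : G} (hg : g * r = r * g) {v : V} (hv : ρ r v = v) :
    ρ r (ρ g v) = ρ g v := by
  rw [← rho_mul, ← hg, rho_mul, hv]

/-- two elements that agree on the two eigenspaces of `r` are equal -/
theorem ext2 (h : Ctx R ρ z r a s i j s0) {g k : G} (h1 : ∀ v, ρ r v = v → ρ g v = ρ k v)
    (h2 : ∀ v, ρ (z * r) v = v → ρ g v = ρ k v) : g = k := by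
  apply h.inj
  ext v
  have rr : ρ r (ρ r v) = v := by rw [← rho_mul, h.fr.rr, map_one]; rfl
  have e1 := h1 (v + ρ r v) (by rw [map_add, rr, add_comm])
  have e2 := h2 (v - ρ r v) (by rw [rho_mul, h.neg, map_sub, rr]; abel)
  have : v = -((v + ρ r v) + (v - ρ r v)) := by
    nth_rewrite 1 [← neg_two v]; congr 1; abel
  rw [this, map_neg, map_neg, map_add (ρ g) (v + ρ r v), map_add (ρ k) (v + ρ r v), e1, e2]

theorem agree_mul (h : Ctx R ρ z r a s i j s0) {p y c : G} (hy : y * r = r * y)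
    (hc : ∀ v, ρ r v = v → ρ (p * y) v = ρ c v) : ∀ v, ρ r v = v → ρ p v = ρ (c * y⁻¹) v := by
  intro v hv
  have hy' : y⁻¹ * r = r * y⁻¹ := by
    rw [inv_mul_eq_iff_eq_mul, ← mul_assoc, hy, mul_assoc, mul_inv_cancel, mul_one]
  have := hc _ (h.comr hy' hv)
  rw [← rho_mul, ← rho_mul, mul_assoc, mul_inv_cancel, mul_one] at this
  exact this

theorem lemM (h : Ctx R ρ z r a s i j s0) {p : G} (hp : p * r = r * p)
    (hP : ∀ x ∈ R, x * r = r * x → p * x * p⁻¹ = x ∨ p * x * p⁻¹ = z * x ∨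
      p * x * p⁻¹ = r * x ∨ p * x * p⁻¹ = z * r * x) :
    ∃ c ∈ R, c * r = r * c ∧ ∀ v, ρ r v = v → ρ p v = ρ c v := by
  have sgn : ∀ x ∈ R, x * r = r * x → (∀ v, ρ r v = v → ρ x (ρ p v) = ρ p (ρ x v)) ∨
      (∀ v, ρ r v = v → ρ x (ρ p v) = -ρ p (ρ x v)) := by
    intro x hx hxr
    have e : ∀ w : G, p * x * p⁻¹ = w → p * x = w * p := by
      intro w hw; rw [← hw]; group
    have key : ∀ v, ρ p (ρ x v) = ρ (p * x) v := fun v => (rho_mul ρ p x v).symm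
    rcases hP x hx hxr with h1 | h1 | h1 | h1 <;> have h1 := e _ h1
    · left; intro v hv; rw [key, h1, rho_mul]
    · right; intro v hv; rw [key, h1, mul_assoc, rho_mul, h.neg, rho_mul, neg_neg]
    · left; intro v hv
      rw [key, h1, mul_assoc, rho_mul, rho_mul]
      rw [h.comr hxr (h.comr hp hv)]
    · right; intro v hv
      rw [key, h1, mul_assoc, mul_assoc, rho_mul, h.neg, rho_mul, rho_mul, neg_neg]
      rw [h.comr hxr (h.comr hp hv)]
  -- final step
  have fin0 : ∀ q : G, q * r = r * q → (∀ v, ρ r v = v → ρ a (ρ q v) = ρ q (ρ a v)) →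
      (∀ v, ρ r v = v → ρ s (ρ q v) = ρ q (ρ s v)) →
      (∀ v, ρ r v = v → ρ i (ρ q v) = ρ q (ρ i v)) →
      (∀ v, ρ r v = v → ρ j (ρ q v) = ρ q (ρ j v)) →
      ∃ c ∈ R, c * r = r * c ∧ ∀ v, ρ r v = v → ρ q v = ρ c v := by
    intro q hq qa qs qi qj
    rcases schur ρ h.fr h.hz' h.fd (ρ q) (rho_inj ρ q) (fun v hv => h.comr hq hv) qa qs qi qj with
      h1 | h1
    · exact ⟨1, one_mem _, by simp, fun v hv => by rw [h1 v hv, map_one]; rfl⟩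
    · exact ⟨z, h.hz, (h.zcen r).symm, fun v hv => h1 v hv⟩
  have red : ∀ (q y : G), y ∈ R → y * r = r * y →
      (∃ c ∈ R, c * r = r * c ∧ ∀ v, ρ r v = v → ρ (q * y) v = ρ c v) →
      ∃ c ∈ R, c * r = r * c ∧ ∀ v, ρ r v = v → ρ q v = ρ c v := by
    rintro q y hyR hyr ⟨c, hc, hcr, hcv⟩
    refine ⟨c * y⁻¹, mul_mem hc (inv_mem hyR), ?_, h.agree_mul hyr hcv⟩
    exact memCent.1 (mul_mem (memCent.2 hcr) (inv_mem (memCent.2 hyr)))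
  have stX : ∀ (q x y : G), y * r = r * y → x * y = y * x →
      (∀ v, ρ r v = v → ρ x (ρ q v) = ρ q (ρ x v)) →
      (∀ v, ρ r v = v → ρ x (ρ (q * y) v) = ρ (q * y) (ρ x v)) := by
    intro q x y hyr hxy hx v hv
    rw [rho_mul, rho_mul, hx _ (h.comr hyr hv), ← rho_mul ρ x, hxy, rho_mul ρ y]
  have stN : ∀ (q x y : G), y * r = r * y → x * y = y * x →
      (∀ v, ρ r v = v → ρ x (ρ q v) = -ρ q (ρ x v)) →
      (∀ v, ρ r v = v → ρ x (ρ (q * y) v) = -ρ (q * y) (ρ x v)) := by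
    intro q x y hyr hxy hx v hv
    rw [rho_mul, rho_mul, hx _ (h.comr hyr hv), ← rho_mul ρ x, hxy, rho_mul ρ y]
  have stF : ∀ (q x y : G), y * r = r * y → x * y = z * (y * x) →
      (∀ v, ρ r v = v → ρ x (ρ q v) = -ρ q (ρ x v)) →
      (∀ v, ρ r v = v → ρ x (ρ (q * y) v) = ρ (q * y) (ρ x v)) := by
    intro q x y hyr hxy hx v hv
    rw [rho_mul, rho_mul, hx _ (h.comr hyr hv), ← rho_mul ρ x, hxy, rho_mul, h.neg, rho_mul ρ y,
      map_neg, neg_neg]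
  have F := h.fr
  have sa : s * a = z * (a * s) := by rw [F.as, ← mul_assoc, F.zz, one_mul]
  have ji : j * i = z * (i * j) := by rw [F.ij, ← mul_assoc, F.zz, one_mul]
  have mR : ∀ {q y : G}, q * r = r * q → y * r = r * y → (q * y) * r = r * (q * y) :=
    fun h1 h2 => memCent.1 (mul_mem (memCent.2 h1) (memCent.2 h2))
  have fin1 : ∀ q : G, q * r = r * q → (∀ v, ρ r v = v → ρ a (ρ q v) = ρ q (ρ a v)) →
      (∀ v, ρ r v = v → ρ s (ρ q v) = ρ q (ρ s v)) →
      (∀ v, ρ r v = v → ρ i (ρ q v) = ρ q (ρ i v)) →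
      ((∀ v, ρ r v = v → ρ j (ρ q v) = ρ q (ρ j v)) ∨
       (∀ v, ρ r v = v → ρ j (ρ q v) = -ρ q (ρ j v))) →
      ∃ c ∈ R, c * r = r * c ∧ ∀ v, ρ r v = v → ρ q v = ρ c v := by
    intro q hq qa qs qi qj
    rcases qj with qj | qj
    · exact fin0 q hq qa qs qi qj
    · exact red q i h.hi F.ri (fin0 (q * i) (mR hq F.ri) (stX q a i F.ri F.ia.symm qa)
        (stX q s i F.ri F.is.symm qs) (stX q i i F.ri rfl qi) (stF q j i F.ri ji qj))
  have fin2 : ∀ q : G, q * r = r * q → (∀ v, ρ r v = v → ρ a (ρ q v) = ρ q (ρ a v)) →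
      (∀ v, ρ r v = v → ρ s (ρ q v) = ρ q (ρ s v)) →
      ((∀ v, ρ r v = v → ρ i (ρ q v) = ρ q (ρ i v)) ∨
       (∀ v, ρ r v = v → ρ i (ρ q v) = -ρ q (ρ i v))) →
      ((∀ v, ρ r v = v → ρ j (ρ q v) = ρ q (ρ j v)) ∨
       (∀ v, ρ r v = v → ρ j (ρ q v) = -ρ q (ρ j v))) →
      ∃ c ∈ R, c * r = r * c ∧ ∀ v, ρ r v = v → ρ q v = ρ c v := by
    intro q hq qa qs qi qj
    rcases qi with qi | qi
    · exact fin1 q hq qa qs qi qj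
    · exact red q j h.hj F.rj (fin1 (q * j) (mR hq F.rj) (stX q a j F.rj F.ja.symm qa)
        (stX q s j F.rj F.js.symm qs) (stF q i j F.rj F.ij qi)
        (qj.imp (stX q j j F.rj rfl) (stN q j j F.rj rfl)))
  have fin3 : ∀ q : G, q * r = r * q → (∀ v, ρ r v = v → ρ a (ρ q v) = ρ q (ρ a v)) →
      ((∀ v, ρ r v = v → ρ s (ρ q v) = ρ q (ρ s v)) ∨
       (∀ v, ρ r v = v → ρ s (ρ q v) = -ρ q (ρ s v))) →
      ((∀ v, ρ r v = v → ρ i (ρ q v) = ρ q (ρ i v)) ∨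
       (∀ v, ρ r v = v → ρ i (ρ q v) = -ρ q (ρ i v))) →
      ((∀ v, ρ r v = v → ρ j (ρ q v) = ρ q (ρ j v)) ∨
       (∀ v, ρ r v = v → ρ j (ρ q v) = -ρ q (ρ j v))) →
      ∃ c ∈ R, c * r = r * c ∧ ∀ v, ρ r v = v → ρ q v = ρ c v := by
    intro q hq qa qs qi qj
    rcases qs with qs | qs
    · exact fin2 q hq qa qs qi qj
    · exact red q a h.ha F.ra (fin2 (q * a) (mR hq F.ra) (stX q a a F.ra rfl qa)
        (stF q s a F.ra sa qs)
        (qi.imp (stX q i a F.ra F.ia) (stN q i a F.ra F.ia))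
        (qj.imp (stX q j a F.ra F.ja) (stN q j a F.ra F.ja)))
  have pa := sgn a h.ha F.ra
  have ps := sgn s h.hs F.rs
  have pi := sgn i h.hi F.ri
  have pj := sgn j h.hj F.rj
  rcases pa with pa | pa
  · exact fin3 p hp pa ps pi pj
  · exact red p s h.hs F.rs (fin3 (p * s) (mR hp F.rs) (stF p a s F.rs F.as pa)
        (ps.imp (stX p s s F.rs rfl) (stN p s s F.rs rfl))
        (pi.imp (stX p i s F.rs F.is) (stN p i s F.rs F.is))
        (pj.imp (stX p j s F.rs F.js) (stN p j s F.rs F.js)))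

end Ctx
end TA

section TB
open Module
set_option linter.unusedSectionVars false

variable {G V : Type*} [Group G] [Finite G] [AddCommGroup V] [Module (ZMod 3) V]
  [FiniteDimensional (ZMod 3) V]
  {R : Subgroup G} {ρ : G →* Module.End (ZMod 3) V} {z r a s i j s0 : G}

/-- `g` and `k` agree on the fixed vectors of `t` -/
def Ag (ρ : G →* Module.End (ZMod 3) V) (t g k : G) : Prop := ∀ v, ρ t v = v → ρ g v = ρ k v

theorem rho_one' (ρ : G →* Module.End (ZMod 3) V) (v : V) : ρ 1 v = v := by rw [map_one]; rfl

theorem fixcom {ρ : G →* Module.End (ZMod 3) V} {t g : G} (hg : g * t = t * g) {v : V}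
    (hv : ρ t v = v) : ρ t (ρ g v) = ρ g v := by
  rw [← rho_mul, ← hg, rho_mul, hv]

namespace Ag

theorem rfl' {t g : G} : Ag ρ t g g := fun _ _ => rfl

theorem symm' {t g k : G} (h : Ag ρ t g k) : Ag ρ t k g := fun v hv => (h v hv).symm

theorem trans' {t g k l : G} (h : Ag ρ t g k) (h' : Ag ρ t k l) : Ag ρ t g l :=
  fun v hv => (h v hv).trans (h' v hv)

theorem mul' {t g k g' k' : G} (h : Ag ρ t g k) (h' : Ag ρ t g' k') (hk : k' * t = t * k') :
    Ag ρ t (g * g') (k * k') := by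
  intro v hv
  rw [rho_mul, rho_mul, h' v hv, h _ (fixcom hk hv)]

theorem inv' {t g k : G} (h : Ag ρ t g k) (hk : k * t = t * k) : Ag ρ t g⁻¹ k⁻¹ := by
  intro v hv
  have hk' : k⁻¹ * t = t * k⁻¹ := memCent.1 (inv_mem (memCent.2 hk))
  have e := h _ (fixcom hk' hv)
  rw [← rho_mul ρ k, mul_inv_cancel, rho_one'] at e
  conv_lhs => rw [← e, ← rho_mul, inv_mul_cancel, rho_one']

end Ag

/-- the kernel of the action of the centralizer of `r` on the fixed vectors of `r` -/
def Kx (ρ : G →* Module.End (ZMod 3) V) (r : G) : Subgroup G where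
  carrier := {g | g * r = r * g ∧ Ag ρ r g 1}
  one_mem' := ⟨by simp, Ag.rfl'⟩
  mul_mem' := by
    rintro x y ⟨h1, h2⟩ ⟨h3, h4⟩
    refine ⟨memCent.1 (mul_mem (memCent.2 h1) (memCent.2 h3)), ?_⟩
    simpa using h2.mul' h4 (by simp)
  inv_mem' := by
    rintro x ⟨h1, h2⟩
    refine ⟨memCent.1 (inv_mem (memCent.2 h1)), ?_⟩
    simpa using h2.inv' (by simp)

theorem mem_Kx {g : G} : g ∈ Kx ρ r ↔ g * r = r * g ∧ Ag ρ r g 1 := Iff.rfl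

theorem cmul {r x y : G} (hx : x * r = r * x) (hy : y * r = r * y) :
    (x * y) * r = r * (x * y) := memCent.1 (mul_mem (memCent.2 hx) (memCent.2 hy))

theorem cinv {r x : G} (hx : x * r = r * x) : x⁻¹ * r = r * x⁻¹ :=
  memCent.1 (inv_mem (memCent.2 hx))

/-- elements of `C` agreeing with an element of `A` on the fixed vectors of `t` -/
def Tl (R : Subgroup G) (ρ : G →* Module.End (ZMod 3) V) (t : G) (A : Subgroup G) :
    Subgroup G where
  carrier := {c | c ∈ R ∧ c * t = t * c ∧ ∃ k ∈ A, Ag ρ t k c}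
  one_mem' := ⟨one_mem _, by simp, 1, one_mem _, Ag.rfl'⟩
  mul_mem' := by
    rintro x y ⟨h1, h2, k, hk, h3⟩ ⟨h4, h5, l, hl, h6⟩
    exact ⟨mul_mem h1 h4, cmul h2 h5, k * l, mul_mem hk hl, h3.mul' h6 h5⟩
  inv_mem' := by
    rintro x ⟨h1, h2, k, hk, h3⟩
    exact ⟨inv_mem h1, cinv h2, k⁻¹, inv_mem hk, h3.inv' h2⟩

theorem mem_Tl {t c : G} {A : Subgroup G} :
    c ∈ Tl R ρ t A ↔ c ∈ R ∧ c * t = t * c ∧ ∃ k ∈ A, Ag ρ t k c := Iff.rfl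

namespace Ctx

theorem fixC (h : Ctx R ρ z r a s i j s0) {c : G} (hc : c ∈ R)
    (hA : Ag ρ r c 1) : c = 1 ∨ c = r := by
  obtain ⟨v, hv, hv0⟩ := h.Une
  have hcv : ∀ v, ρ r v = v → ρ c v = v := fun v hv => by rw [hA v hv, rho_one']
  have := h.cenC c hc (by
    intro t ht htr
    rcases h.cm t ht c hc with e | e
    · exact e
    · exfalso
      have e2 : ρ (t * c) v = ρ (z * (c * t)) v := by rw [e]
      rw [rho_mul, rho_mul, rho_mul, h.neg, hcv v hv, hcv _ (h.comr htr hv)] at e2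
      have e3 := eq_zero_of_neg e2
      apply hv0
      apply rho_inj ρ t
      rw [e3, map_zero])
  rcases this with e | e | e | e
  · exact Or.inl e
  · exfalso
    have := hcv v hv
    rw [e, h.neg] at this
    exact hv0 (eq_zero_of_neg this.symm)
  · exact Or.inr e
  · exfalso
    have := hcv v hv
    rw [e, rho_mul, hv, h.neg] at this
    exact hv0 (eq_zero_of_neg this.symm)

theorem fixC' (h : Ctx R ρ z r a s i j s0) {c : G} (hc : c ∈ R)
    (hA : Ag ρ (z * r) c 1) : c = 1 ∨ c = z * r := h.swap.fixC hc hA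

theorem ext1 (h : Ctx R ρ z r a s i j s0) {g k : G} (hg : Ag ρ r g 1) (hk : Ag ρ r k 1)
    (hh : Ag ρ (z * r) g k) : g = k := h.ext2 (hg.trans' hk.symm') hh

theorem Agzr (h : Ctx R ρ z r a s i j s0) : Ag ρ (z * r) z r := by
  intro v hv
  rw [rho_mul] at hv
  rw [h.neg] at hv
  rw [h.neg]
  exact neg_eq_iff_eq_neg.2 hv.symm

theorem r_mem (h : Ctx R ρ z r a s i j s0) : r ∈ Kx ρ r :=
  ⟨rfl, fun v hv => by rw [hv, rho_one']⟩

theorem kc (h : Ctx R ρ z r a s i j s0) {k : G} (hk : k ∈ Kx ρ r) :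
    ∃ c ∈ R, c * r = r * c ∧ Ag ρ (z * r) k c := by
  obtain ⟨hkr, hkA⟩ := hk
  obtain ⟨c, hc, hcr, hA⟩ := h.swap.lemM (p := k) ((h.comm_zr k).2 hkr) (by
    intro x hx hxr
    have hxr := (h.comm_zr x).1 hxr
    have h1 : k * x * k⁻¹ * x⁻¹ ∈ R := mul_mem (h.Rn.conj_mem x hx k) (inv_mem hx)
    have h2 : Ag ρ r (k * x * k⁻¹ * x⁻¹) 1 := by
      have := ((hkA.mul' (Ag.rfl' (g := x)) hxr).mul' (hkA.inv' (by simp)) (by simp)).mul'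
        (Ag.rfl' (g := x⁻¹)) (cinv hxr)
      simpa using this
    rw [h.zzr]
    rcases h.fixC h1 h2 with e | e
    · left; exact mul_inv_eq_one.1 e
    · right; right; right; exact mul_inv_eq_iff_eq_mul.1 e)
  exact ⟨c, hc, (h.comm_zr c).1 hcr, hA⟩

theorem Wk (h : Ctx R ρ z r a s i j s0) {k c : G} (hk : k ∈ Kx ρ r) (hA : Ag ρ (z * r) k c)
    (hc : c = 1 ∨ c = z ∨ c = r ∨ c = z * r) : k = 1 ∨ k = r := by
  have hr : Ag ρ r r 1 := h.r_mem.2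
  rcases hc with e | e | e | e <;> subst e
  · left; exact h.ext1 hk.2 Ag.rfl' hA
  · right; exact h.ext1 hk.2 hr (hA.trans' h.Agzr)
  · right; exact h.ext1 hk.2 hr hA
  · left; exact h.ext1 hk.2 Ag.rfl' (hA.trans' h.swap.r_mem.2)

theorem ksq (h : Ctx R ρ z r a s i j s0) {k : G} (hk : k ∈ Kx ρ r) : k * k = 1 ∨ k * k = r := by
  obtain ⟨c, hc, hcr, hA⟩ := h.kc hk
  have := hA.mul' hA ((h.comm_zr c).2 hcr)
  refine h.Wk (mul_mem hk hk) this ?_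
  rcases h.sq c hc with e | e <;> tauto

theorem cnt (h : Ctx R ρ z r a s i j s0) (A : Subgroup G) (hA : A ≤ Kx ρ r) :
    2 * Nat.card A ≤ Nat.card (Tl R ρ (z * r) A) := by
  choose c hcR hcr hcA using fun k : A => h.kc (hA k.2)
  have hw : ∀ b : Bool, (cond b (z * r) 1) ∈ R ∧ Ag ρ (z * r) (cond b (z * r) 1) 1 ∧
      (cond b (z * r) 1) * (z * r) = (z * r) * (cond b (z * r) 1) := by
    rintro (_ | _)
    · exact ⟨one_mem _, Ag.rfl', by simp⟩
    · exact ⟨h.swap.hr, h.swap.r_mem.2, rfl⟩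
  have hmem : ∀ p : Bool × A, c p.2 * cond p.1 (z * r) 1 ∈ Tl R ρ (z * r) A ∧
      Ag ρ (z * r) (p.2 : G) (c p.2 * cond p.1 (z * r) 1) := by
    rintro ⟨b, k⟩
    have hag : Ag ρ (z * r) (k : G) (c k * cond b (z * r) 1) := by
      have := (hcA k).mul' (hw b).2.1.symm' (hw b).2.2
      simpa using this
    exact ⟨⟨mul_mem (hcR k) (hw b).1, cmul ((h.comm_zr _).2 (hcr k)) (hw b).2.2, k, k.2, hag⟩, hag⟩
  let f : Bool × A → Tl R ρ (z * r) A := fun p => ⟨c p.2 * cond p.1 (z * r) 1, (hmem p).1⟩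
  have hf : Function.Injective f := by
    rintro ⟨b, k⟩ ⟨b', k'⟩ e
    have e : c k * cond b (z * r) 1 = c k' * cond b' (z * r) 1 := congrArg Subtype.val e
    have h1 := (hmem (b, k)).2
    have h2 := (hmem (b', k')).2
    simp only at h1 h2
    rw [e] at h1
    have : k = k' := Subtype.ext (h.ext1 (hA k.2).2 (hA k'.2).2 (h1.trans' h2.symm'))
    subst this
    have e2 := mul_left_cancel e
    have : b = b' := by
      cases b <;> cases b' <;> simp only [cond_true, cond_false] at e2 ⊢
      · exact absurd e2.symm h.swap.r1
      · exact absurd e2 h.swap.r1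
    rw [this]
  have := Nat.card_le_card_of_injective f hf
  rwa [Nat.card_prod, Nat.card_eq_fintype_card (α := Bool), Fintype.card_bool] at this

theorem Tl_le (h : Ctx R ρ z r a s i j s0) (A : Subgroup G) :
    Tl R ρ (z * r) A ≤ R ⊓ Subgroup.centralizer {r} := by
  rintro c ⟨h1, h2, -⟩
  exact ⟨h1, memCent.2 ((h.comm_zr c).1 h2)⟩

theorem cardK_le (h : Ctx R ρ z r a s i j s0) : Nat.card (Kx ρ r) ≤ 32 := by
  have h1 := h.cnt _ le_rfl
  have h2 := Subgroup.card_le_of_le (h.Tl_le (Kx ρ r))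
  rw [h.cardC] at h2
  omega

theorem surjK (h : Ctx R ρ z r a s i j s0) (hK : Nat.card (Kx ρ r) = 32) {c : G} (hc : c ∈ R)
    (hcr : c * r = r * c) : ∃ k ∈ Kx ρ r, Ag ρ (z * r) k c := by
  have h1 := h.cnt _ le_rfl
  have := Subgroup.eq_of_le_of_card_ge (h.Tl_le (Kx ρ r)) (by rw [h.cardC]; omega)
  have hm : c ∈ Tl R ρ (z * r) (Kx ρ r) := by rw [this]; exact ⟨hc, memCent.2 hcr⟩
  exact hm.2.2

theorem cenK (h : Ctx R ρ z r a s i j s0) (hK : Nat.card (Kx ρ r) = 32) {k : G}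
    (hk : k ∈ Kx ρ r) (hkc : ∀ x ∈ Kx ρ r, k * x = x * k) : k = 1 ∨ k = r := by
  obtain ⟨c, hc, hcr, hA⟩ := h.kc hk
  refine h.Wk hk hA (h.cenC c hc ?_)
  intro t ht htr
  obtain ⟨x, hx, hxA⟩ := h.surjK hK ht htr
  have h1 : Ag ρ (z * r) (t * c) (c * t) := by
    have e1 := hA.mul' hxA ((h.comm_zr t).2 htr)
    have e2 := hxA.mul' hA ((h.comm_zr c).2 hcr)
    rw [hkc x hx] at e1
    exact e2.symm'.trans' e1
  rcases h.cm t ht c hc with e | e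
  · exact e
  · exfalso
    obtain ⟨v, hv, hv0⟩ := h.swap.Une
    have h2 := h1 v hv
    rw [e, rho_mul ρ z, h.neg] at h2
    have := eq_zero_of_neg h2.symm
    apply hv0
    apply rho_inj ρ (c * t)
    rw [this, map_zero]

theorem elA (h : Ctx R ρ z r a s i j s0) (A : Subgroup G) (hA : A ≤ Kx ρ r)
    (hAA : ∀ x ∈ A, x * x = 1) : Nat.card A ≤ 4 := by
  have h1 := h.cnt A hA
  have h2 := h.mini (Tl R ρ (z * r) A) ((h.Tl_le A).trans inf_le_left) (by
    rintro c ⟨hc, hcr, k, hk, hAg⟩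
    have e := hAg.mul' hAg hcr
    rw [hAA k hk] at e
    rcases h.fixC' (mul_mem hc hc) e.symm' with e1 | e1
    · exact e1
    · rcases h.sq c hc with e2 | e2
      · exact e2
      · exfalso
        rw [e2] at e1
        exact h.swap.rz e1.symm)
  omega

theorem exA (h : Ctx R ρ z r a s i j s0) (hK : Nat.card (Kx ρ r) = 32) :
    ∃ k ∈ Kx ρ r, k * k = 1 ∧ k ≠ 1 ∧ k ≠ r := by
  obtain ⟨k, hk, hA⟩ := h.surjK hK h.ha h.fr.ra
  have e0 := (h.comm_zr a).2 h.fr.ra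
  refine ⟨k, hk, ?_, ?_, ?_⟩
  · have := hA.mul' hA e0
    rw [h.fr.aa] at this
    exact h.ext1 (mul_mem hk hk).2 Ag.rfl' this
  · rintro rfl
    have := h.aN
    rcases h.fixC' h.ha hA.symm' with e | e <;> tauto
  · rintro rfl
    have h2 := (hA.symm').mul' (h.Agzr.symm') (h.zcen _).symm
    have : Ag ρ (z * k) (a * k) 1 := by
      refine h2.trans' ?_
      intro v hv
      rw [h.zcen k, hv, rho_one']
    have := h.aN
    rcases h.fixC' (mul_mem h.ha h.hr) ‹_› with e | e
    · have : a = k := by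
        rw [mul_eq_one_iff_eq_inv] at e
        rw [e, inv_eq_iff_mul_eq_one, h.fr.rr]
      tauto
    · have := mul_right_cancel e
      tauto

end Ctx
end TB

section TC
open Module
set_option linter.unusedSectionVars false

/-- fixed points of an element of order dividing 5 -/
theorem fix5 {G : Type*} [Group G] [Finite G] (S : Subgroup G) (g : G) (hg : g ^ 5 = 1)
    (hS : ∀ x ∈ S, g * x * g⁻¹ ∈ S) :
    Nat.card S ≡ Nat.card (S ⊓ Subgroup.centralizer {g} : Subgroup G) [MOD 5] := by
  classical
  haveI := Fintype.ofFinite S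
  haveI : Fact (Nat.Prime 5) := ⟨by norm_num⟩
  let f : Function.End S := fun x => ⟨g * x * g⁻¹, hS x x.2⟩
  have hfn : ∀ (n : ℕ) (x : S), (((f ^ n : Function.End S) x : S) : G) = g ^ n * x * (g ^ n)⁻¹ := by
    intro n
    induction n with
    | zero => intro x; simp [Function.End.one_def]
    | succ n ih =>
      intro x
      have : (f ^ (n + 1) : Function.End S) x = (f ^ n : Function.End S) (f x) := by
        rw [pow_succ]; rfl
      rw [this, ih]
      change g ^ n * (g * x * g⁻¹) * (g ^ n)⁻¹ = _
      rw [pow_succ]; group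
  have hf : f ^ 5 ^ 1 = 1 := by
    funext x
    apply Subtype.ext
    rw [pow_one, hfn, hg]; simp [Function.End.one_def]
  have := Equiv.Perm.card_fixedPoints_modEq hf
  rw [← Nat.card_eq_fintype_card, ← Nat.card_eq_fintype_card] at this
  have e : Nat.card (Function.fixedPoints f) =
      Nat.card (S ⊓ Subgroup.centralizer {g} : Subgroup G) := by
    refine Nat.card_congr ⟨fun x => ⟨x.1.1, x.1.2, ?_⟩, fun x => ⟨⟨x.1, x.2.1⟩, ?_⟩, ?_, ?_⟩
    · have h1 : f x.1 = x.1 := x.2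
      have h2 : g * x.1.1 * g⁻¹ = x.1.1 := congrArg Subtype.val h1
      exact memCent.2 (mul_inv_eq_iff_eq_mul.1 h2).symm
    · have h1 := memCent.1 x.2.2
      apply Subtype.ext
      exact mul_inv_eq_iff_eq_mul.2 h1.symm
    · intro x; rfl
    · intro x; rfl
  rw [← e]; exact this

variable {G V : Type*} [Group G] [Finite G] [AddCommGroup V] [Module (ZMod 3) V]
  [FiniteDimensional (ZMod 3) V]
  {R : Subgroup G} {ρ : G →* Module.End (ZMod 3) V} {z r a s i j s0 : G}

namespace Ctx

/-- the four-group generated by `z` and `r` -/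
def W (h : Ctx R ρ z r a s i j s0) : Subgroup G where
  carrier := {x | x = 1 ∨ x = z ∨ x = r ∨ x = z * r}
  one_mem' := Or.inl rfl
  mul_mem' := by
    have zz := h.fr.zz
    have rr := h.fr.rr
    have rz : r * z = z * r := h.zcen r
    have e1 : z * (z * r) = r := h.zzr
    have e2 : r * (z * r) = z := by rw [← mul_assoc, rz, mul_assoc, rr, mul_one]
    have e3 : (z * r) * z = r := by rw [mul_assoc, rz, e1]
    have e4 : (z * r) * r = z := by rw [mul_assoc, rr, mul_one]
    have e5 : (z * r) * (z * r) = 1 := by rw [mul_assoc, e2, zz]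
    rintro x y (rfl | rfl | rfl | rfl) (rfl | rfl | rfl | rfl) <;>
      simp [zz, rr, rz, e1, e2, e3, e4, e5]
  inv_mem' := by
    have zz := h.fr.zz
    have rr := h.fr.rr
    have rz : r * z = z * r := h.zcen r
    have e1 : z⁻¹ = z := inv_eq_of_mul_eq_one_left zz
    have e2 : r⁻¹ = r := inv_eq_of_mul_eq_one_left rr
    rintro x (rfl | rfl | rfl | rfl) <;> simp [e1, e2, rz]

theorem mem_W (h : Ctx R ρ z r a s i j s0) {x : G} :
    x ∈ h.W ↔ x = 1 ∨ x = z ∨ x = r ∨ x = z * r := Iff.rfl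

theorem cardW (h : Ctx R ρ z r a s i j s0) : Nat.card h.W = 4 := by
  have e : (h.W : Set G) = {1, z, r, z * r} := by
    ext x; simp [mem_W]
  have h2 : r ≠ z * r := fun e => h.z1 (by simpa using e.symm)
  have : Nat.card h.W = Set.ncard (h.W : Set G) := rfl
  rw [this, e, Set.ncard_insert_of_notMem, Set.ncard_insert_of_notMem, Set.ncard_insert_of_notMem,
    Set.ncard_singleton]
  · simpa using h2
  · simpa using ⟨h.rz.symm, h.r1⟩
  · simpa using ⟨h.z1.symm, h.r1.symm, h.swap.r1.symm⟩

theorem Wcomm (h : Ctx R ρ z r a s i j s0) {w x : G} (hw : w ∈ h.W) (hx : x * r = r * x) :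
    x * w = w * x := by
  rcases hw with rfl | rfl | rfl | rfl
  · simp
  · exact h.zcen x
  · exact hx
  · exact (h.comm_zr x).2 hx

theorem W_le (h : Ctx R ρ z r a s i j s0) : h.W ≤ R ⊓ Subgroup.centralizer {r} := by
  rintro w hw
  refine ⟨?_, memCent.2 (h.Wcomm hw rfl).symm⟩
  rcases hw with rfl | rfl | rfl | rfl
  · exact one_mem _
  · exact h.hz
  · exact h.hr
  · exact h.swap.hr

/-- noncentral involutions of `C` -/
def Th (h : Ctx R ρ z r a s i j s0) : Set G :=
  {x | x ∈ R ⊓ Subgroup.centralizer {r} ∧ x * x = 1 ∧ x ∉ h.W}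

theorem cardTh (h : Ctx R ρ z r a s i j s0) : h.Th.ncard = 20 := by
  have e : {x : G | x ∈ R ⊓ Subgroup.centralizer {r} ∧ x * x = 1} = h.Th ∪ (h.W : Set G) := by
    ext x
    by_cases hx : x ∈ h.W
    · have h1 := h.W_le hx
      have h2 : x * x = 1 := by
        rcases hx with rfl | rfl | rfl | rfl
        · simp
        · exact h.fr.zz
        · exact h.fr.rr
        · exact h.swap.fr.rr
      simp only [Set.mem_ofPred_eq, Set.mem_union, SetLike.mem_coe, hx, or_true, iff_true]
      exact ⟨h1, h2⟩
    · simp [Th, hx]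
  have h1 : ({x : G | x ∈ R ⊓ Subgroup.centralizer {r} ∧ x * x = 1}).ncard = 24 := h.c24
  have h2 : (h.W : Set G).ncard = 4 := h.cardW
  have h3 : Disjoint h.Th (h.W : Set G) := by
    rw [Set.disjoint_left]
    rintro x ⟨_, _, hx⟩ hx'
    exact hx hx'
  rw [e, Set.ncard_union_eq h3, h2] at h1
  omega

/-- right cosets -/
def bl (h : Ctx R ρ z r a s i j s0) (x : G) : Set G := {y | y * x⁻¹ ∈ h.W}

theorem bl_eq (h : Ctx R ρ z r a s i j s0) {x y : G} (hxy : h.bl x = h.bl y) : x * y⁻¹ ∈ h.W := by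
  have : x ∈ h.bl x := by simp [bl, one_mem]
  rw [hxy] at this
  exact this

theorem bl_mul (h : Ctx R ρ z r a s i j s0) {w : G} (hw : w ∈ h.W) (x : G) :
    h.bl (w * x) = h.bl x := by
  ext y
  simp only [bl, Set.mem_ofPred_eq, mul_inv_rev, ← mul_assoc]
  exact h.W.mul_mem_cancel_right (inv_mem hw)

theorem bl_conj (h : Ctx R ρ z r a s i j s0) {d : G} (hd : d * r = r * d) (x : G) :
    (fun y => d * y * d⁻¹) '' h.bl x = h.bl (d * x * d⁻¹) := by
  ext y
  simp only [bl, Set.mem_image, Set.mem_ofPred_eq]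
  constructor
  · rintro ⟨y, hy, rfl⟩
    have : d * y * d⁻¹ * (d * x * d⁻¹)⁻¹ = d * (y * x⁻¹) * d⁻¹ := by group
    rw [this, h.Wcomm hy hd, mul_inv_cancel_right]
    exact hy
  · intro hy
    refine ⟨d⁻¹ * y * d, ?_, by group⟩
    have : d⁻¹ * y * d * x⁻¹ = d⁻¹ * (y * (d * x * d⁻¹)⁻¹) * d := by group
    rw [this, h.Wcomm hy (cinv hd), inv_mul_cancel_right]
    exact hy

def Om (h : Ctx R ρ z r a s i j s0) : Set (Set G) := h.bl '' h.Th

theorem cardOm (h : Ctx R ρ z r a s i j s0) : Nat.card h.Om ≤ 5 := by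
  choose x hx hxe using fun w : h.Om => w.2
  have hm : ∀ p : h.W × h.Om, p.1.1 * x p.2 ∈ h.Th := by
    rintro ⟨w, o⟩
    obtain ⟨h1, h2, h3⟩ := hx o
    have hxr := memCent.1 h1.2
    refine ⟨mul_mem (h.W_le w.2) h1, ?_, fun h4 => h3 ((h.W.mul_mem_cancel_left w.2).1 h4)⟩
    have hw2 : w.1 * w.1 = 1 := by
      rcases w.2 with e | e | e | e <;> rw [e]
      · simp
      · exact h.fr.zz
      · exact h.fr.rr
      · exact h.swap.fr.rr
    change w.1 * x o * (w.1 * x o) = 1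
    rw [mul_assoc, ← mul_assoc (x o), h.Wcomm w.2 hxr, mul_assoc, h2, mul_one, hw2]
  let f : h.W × h.Om → h.Th := fun p => ⟨p.1.1 * x p.2, hm p⟩
  have hf : Function.Injective f := by
    rintro ⟨w, o⟩ ⟨w', o'⟩ e
    have e : w.1 * x o = w'.1 * x o' := congrArg Subtype.val e
    have h1 : h.bl (x o) = h.bl (x o') := by
      rw [← h.bl_mul w.2, e, h.bl_mul w'.2]
    rw [hxe, hxe] at h1
    have h2 : o = o' := Subtype.ext h1
    subst h2
    have := mul_right_cancel e
    rw [Subtype.ext this]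
  have h1 := Nat.card_le_card_of_injective f hf
  have h2 : Nat.card h.Th = 20 := h.cardTh
  rw [Nat.card_prod, h.cardW, h2] at h1
  omega

instance act (h : Ctx R ρ z r a s i j s0) : MulAction (Subgroup.centralizer ({r} : Set G)) h.Om where
  smul d o := ⟨(fun y => d.1 * y * d.1⁻¹) '' o.1, by
    obtain ⟨o, x, ⟨hx1, hx2, hx3⟩, rfl⟩ := o
    have hd := memCent.1 d.2
    refine ⟨d.1 * x * d.1⁻¹, ⟨⟨h.Rn.conj_mem x hx1.1 _, memCent.2 (cmul (cmul hd (memCent.1 hx1.2)) (cinv hd))⟩, ?_, ?_⟩,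
      (h.bl_conj hd x).symm⟩
    · have : d.1 * x * d.1⁻¹ * (d.1 * x * d.1⁻¹) = d.1 * (x * x) * d.1⁻¹ := by group
      rw [this, hx2]; group
    · intro hw
      apply hx3
      have := h.Wcomm hw (cinv hd)
      have e : x = d.1⁻¹ * (d.1 * x * d.1⁻¹) * d.1 := by group
      rw [e, this, inv_mul_cancel_right]
      exact hw⟩
  one_smul o := by
    apply Subtype.ext
    change (fun y => (1 : G) * y * (1 : G)⁻¹) '' o.1 = o.1
    simp
  mul_smul d e o := by
    apply Subtype.ext
    change (fun y => (d.1 * e.1) * y * (d.1 * e.1)⁻¹) '' o.1 =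
      (fun y => d.1 * y * d.1⁻¹) '' ((fun y => e.1 * y * e.1⁻¹) '' o.1)
    rw [Set.image_image]
    congr 1
    funext y; group

/-- elements that act trivially on `Om` satisfy the hypothesis of `lemM` -/
theorem triv (h : Ctx R ρ z r a s i j s0) {d : G} (hd : d * r = r * d)
    (hT : ∀ x ∈ h.Th, h.bl (d * x * d⁻¹) = h.bl x) {y : G} (hy : y ∈ R) (hyr : y * r = r * y) :
    d * y * d⁻¹ * y⁻¹ ∈ h.W := by
  have inv : ∀ x ∈ R, x * r = r * x → x * x = 1 → d * x * d⁻¹ * x⁻¹ ∈ h.W := by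
    intro x hx hxr hxx
    by_cases hw : x ∈ h.W
    · rw [h.Wcomm hw hd, mul_inv_cancel_right, mul_inv_cancel]; exact one_mem _
    · exact h.bl_eq (hT x ⟨⟨hx, memCent.2 hxr⟩, hxx, hw⟩)
  rcases h.sq y hy with e | e
  · exact inv y hy hyr e
  · obtain ⟨x, hx, hxr, hxx, hxy⟩ := h.prods y hy hyr e
    have hxy' : x * y = z * (y * x) := (h.cm x hx y hy).resolve_left hxy
    have h1 := inv x hx hxr hxx
    have h2 := inv (x * y) (mul_mem hx hy) (cmul hxr hyr) (by
      nth_rewrite 2 [hxy']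
      rw [← mul_assoc, h.zcen, mul_assoc, mul_assoc, ← mul_assoc y, e, ← mul_assoc x, h.zcen x,
        mul_assoc z x, hxx, mul_one, h.fr.zz])
    have h3 : d * y * d⁻¹ * y⁻¹ = x⁻¹ * ((d * x * d⁻¹ * x⁻¹)⁻¹ * (d * (x * y) * d⁻¹ * (x * y)⁻¹)) * x := by
      group
    rw [h3, h.Wcomm (mul_mem (inv_mem h1) h2) (cinv hxr), inv_mul_cancel_right]
    exact mul_mem (inv_mem h1) h2

theorem lemM2 (h : Ctx R ρ z r a s i j s0) {p : G} (hp : p * r = r * p)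
    (hP : ∀ x ∈ R, x * r = r * x → p * x * p⁻¹ * x⁻¹ ∈ h.W) :
    (∃ c ∈ R, c * r = r * c ∧ Ag ρ r p c) ∧ (∃ c ∈ R, c * r = r * c ∧ Ag ρ (z * r) p c) := by
  constructor
  · refine h.lemM hp ?_
    intro x hx hxr
    rcases hP x hx hxr with e | e | e | e
    · left; exact mul_inv_eq_one.1 e
    · right; left; exact mul_inv_eq_iff_eq_mul.1 e
    · right; right; left; exact mul_inv_eq_iff_eq_mul.1 e
    · right; right; right; exact mul_inv_eq_iff_eq_mul.1 e
  · obtain ⟨c, hc, hcr, hA⟩ := h.swap.lemM ((h.comm_zr p).2 hp) (by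
      intro x hx hxr
      rw [h.zzr]
      rcases hP x hx ((h.comm_zr x).1 hxr) with e | e | e | e
      · left; exact mul_inv_eq_one.1 e
      · right; left; exact mul_inv_eq_iff_eq_mul.1 e
      · right; right; right; exact mul_inv_eq_iff_eq_mul.1 e
      · right; right; left; exact mul_inv_eq_iff_eq_mul.1 e)
    exact ⟨c, hc, (h.comm_zr c).1 hcr, hA⟩

end Ctx
end TC

section TD
open Module
set_option linter.unusedSectionVars false

variable {G V : Type*} [Group G] [Finite G] [AddCommGroup V] [Module (ZMod 3) V]
  [FiniteDimensional (ZMod 3) V]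
  {R : Subgroup G} {ρ : G →* Module.End (ZMod 3) V} {z r a s i j s0 : G}

namespace Ctx

/-- kernel of the action on `Om` -/
noncomputable def Pk (h : Ctx R ρ z r a s i j s0) : Subgroup (Subgroup.centralizer ({r} : Set G)) :=
  (MulAction.toPermHom (Subgroup.centralizer ({r} : Set G)) h.Om).ker

theorem memPk (h : Ctx R ρ z r a s i j s0) (p : h.Pk) :
    ∀ x ∈ R, x * r = r * x → p.1.1 * x * p.1.1⁻¹ * x⁻¹ ∈ h.W := by
  have hp : p.1.1 * r = r * p.1.1 := memCent.1 p.1.2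
  intro x hx hxr
  refine h.triv hp ?_ hx hxr
  intro x hx
  have h1 : MulAction.toPermHom (Subgroup.centralizer ({r} : Set G)) h.Om p.1 = 1 := p.2
  have h2 := congrArg (fun e => (e ⟨h.bl x, x, hx, rfl⟩ : h.Om).1) h1
  rw [← h.bl_conj hp]
  exact h2

theorem cardPk (h : Ctx R ρ z r a s i j s0) : ∃ m, m ∣ 120 ∧
    Nat.card (Subgroup.centralizer ({r} : Set G)) = Nat.card h.Pk * m := by
  refine ⟨h.Pk.index, ?_, (Subgroup.card_mul_index _).symm⟩
  have h1 : h.Pk.index ∣ Nat.card (Equiv.Perm h.Om) := by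
    unfold Pk
    rw [Subgroup.index_ker]
    exact Subgroup.card_subgroup_dvd_card _
  rw [Nat.card_perm] at h1
  exact h1.trans (Nat.factorial_dvd_factorial h.cardOm)

theorem condw (h : Ctx R ρ z r a s i j s0) (b : Bool) :
    (cond b r 1) ∈ R ∧ Ag ρ r (cond b r 1) 1 ∧ (cond b r 1) * r = r * (cond b r 1) := by
  cases b
  · exact ⟨one_mem _, Ag.rfl', by simp⟩
  · exact ⟨h.hr, h.r_mem.2, rfl⟩

/-- the map from `Bool × P` to `C` -/
theorem mapP (h : Ctx R ρ z r a s i j s0) : ∃ f : Bool × h.Pk → (R ⊓ Subgroup.centralizer {r} : Subgroup G),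
    (∀ b p, Ag ρ r p.1.1 (f (b, p)).1) ∧ ∀ b b' p, f (b, p) = f (b', p) → b = b' := by
  choose c hcR hcr hcA using fun p : h.Pk => (h.lemM2 (memCent.1 p.1.2) (h.memPk p)).1
  refine ⟨fun x => ⟨c x.2 * cond x.1 r 1, mul_mem (hcR _) (h.condw _).1,
    memCent.2 (cmul (hcr _) (h.condw _).2.2)⟩, ?_, ?_⟩
  · intro b p
    have := (hcA p).mul' (h.condw b).2.1.symm' (h.condw b).2.2
    simpa using this
  · intro b b' p e
    have e : c p * cond b r 1 = c p * cond b' r 1 := congrArg Subtype.val e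
    have e2 := mul_left_cancel e
    cases b <;> cases b' <;> simp only [cond_true, cond_false] at e2 ⊢
    · exact absurd e2.symm h.r1
    · exact absurd e2 h.r1

theorem mapP' (h : Ctx R ρ z r a s i j s0) : ∃ f : Bool × h.Pk → (R ⊓ Subgroup.centralizer {r} : Subgroup G),
    (∀ b p, Ag ρ (z * r) p.1.1 (f (b, p)).1) ∧ ∀ b b' p, f (b, p) = f (b', p) → b = b' := by
  choose c hcR hcr hcA using fun p : h.Pk => (h.lemM2 (memCent.1 p.1.2) (h.memPk p)).2
  refine ⟨fun x => ⟨c x.2 * cond x.1 (z * r) 1, mul_mem (hcR _) (h.swap.condw _).1,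
    memCent.2 (cmul (hcr _) ((h.comm_zr _).1 (h.swap.condw _).2.2))⟩, ?_, ?_⟩
  · intro b p
    have := (hcA p).mul' (h.swap.condw b).2.1.symm' (h.swap.condw b).2.2
    simpa using this
  · intro b b' p e
    have e : c p * cond b (z * r) 1 = c p * cond b' (z * r) 1 := congrArg Subtype.val e
    have e2 := mul_left_cancel e
    cases b <;> cases b' <;> simp only [cond_true, cond_false] at e2 ⊢
    · exact absurd e2.symm h.swap.r1
    · exact absurd e2 h.swap.r1

theorem cardPk_le (h : Ctx R ρ z r a s i j s0) : Nat.card h.Pk ≤ 1024 := by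
  obtain ⟨f, hf1, hf2⟩ := h.mapP
  obtain ⟨f', hf1', hf2'⟩ := h.mapP'
  let F : Bool × Bool × h.Pk → (R ⊓ Subgroup.centralizer {r} : Subgroup G) ×
      (R ⊓ Subgroup.centralizer {r} : Subgroup G) := fun x => (f (x.1, x.2.2), f' (x.2.1, x.2.2))
  have hF : Function.Injective F := by
    rintro ⟨b, b', p⟩ ⟨d, d', q⟩ e
    have e1 : f (b, p) = f (d, q) := congrArg Prod.fst e
    have e2 : f' (b', p) = f' (d', q) := congrArg Prod.snd e
    have a1 := hf1 b p
    have a2 := hf1' b' p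
    rw [e1] at a1
    rw [e2] at a2
    have : p.1.1 = q.1.1 := h.ext2 (a1.trans' (hf1 d q).symm') (a2.trans' (hf1' d' q).symm')
    have : p = q := Subtype.ext (Subtype.ext this)
    subst this
    rw [hf2 _ _ _ e1, hf2' _ _ _ e2]
  have := Nat.card_le_card_of_injective F hF
  rw [Nat.card_prod, Nat.card_prod, Nat.card_prod, Nat.card_eq_fintype_card (α := Bool),
    Fintype.card_bool, h.cardC] at this
  omega

theorem cardK_ge (h : Ctx R ρ z r a s i j s0) (hP : 321 ≤ Nat.card h.Pk) :
    10 < Nat.card (Kx ρ r) := by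
  classical
  obtain ⟨f, hf1, hf2⟩ := h.mapP
  haveI := Fintype.ofFinite h.Pk
  haveI := Fintype.ofFinite (R ⊓ Subgroup.centralizer {r} : Subgroup G)
  have hlt : Fintype.card (R ⊓ Subgroup.centralizer {r} : Subgroup G) * 10 < Fintype.card (Bool × h.Pk) := by
    rw [← Nat.card_eq_fintype_card, h.cardC, Fintype.card_prod, Fintype.card_bool,
      ← Nat.card_eq_fintype_card]
    omega
  obtain ⟨y, hy⟩ := Fintype.exists_lt_card_fiber_of_mul_lt_card f hlt
  obtain ⟨x0, hx0⟩ : (Finset.univ.filter fun x => f x = y).Nonempty := by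
    rw [← Finset.card_pos]; omega
  have hx0 : f x0 = y := (Finset.mem_filter.1 hx0).2
  refine lt_of_lt_of_le hy ?_
  rw [← Fintype.card_coe, ← Nat.card_eq_fintype_card]
  have key : ∀ x : (Finset.univ.filter fun x => f x = y), f x.1 = y := fun x =>
    (Finset.mem_filter.1 x.2).2
  have hin : ∀ x : (Finset.univ.filter fun x => f x = y), x0.2.1.1⁻¹ * x.1.2.1.1 ∈ Kx ρ r := by
    intro x
    refine ⟨cmul (cinv (memCent.1 x0.2.1.2)) (memCent.1 x.1.2.1.2), ?_⟩
    have a1 := hf1 x.1.1 x.1.2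
    have a0 := hf1 x0.1 x0.2
    rw [key x] at a1
    rw [hx0] at a0
    have hyr := memCent.1 y.2.2
    have := (a0.inv' hyr).mul' a1 hyr
    simpa using this
  refine Nat.card_le_card_of_injective (fun x => (⟨_, hin x⟩ : Kx ρ r)) ?_
  intro x x' e
  have e : x0.2.1.1⁻¹ * x.1.2.1.1 = x0.2.1.1⁻¹ * x'.1.2.1.1 := congrArg Subtype.val e
  have e := mul_left_cancel e
  have e : x.1.2 = x'.1.2 := Subtype.ext (Subtype.ext e)
  obtain ⟨⟨b, p⟩, hx⟩ := x
  obtain ⟨⟨b', p'⟩, hx'⟩ := x'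
  simp only at e
  subst e
  have k1 := key ⟨_, hx⟩
  have k2 := key ⟨_, hx'⟩
  have := hf2 _ _ _ (k1.trans k2.symm)
  subst this
  rfl

theorem cardK (h : Ctx R ρ z r a s i j s0) : Nat.card (Kx ρ r) = 32 := by
  obtain ⟨m, hm, hD⟩ := h.cardPk
  have hP := h.cardPk_le
  have hD1 := h.cardD
  have hm120 : m ≤ 120 := Nat.le_of_dvd (by norm_num) hm
  have hP1 : 321 ≤ Nat.card h.Pk := by
    by_contra hh
    have : Nat.card h.Pk * m ≤ 320 * 120 := Nat.mul_le_mul (by omega) hm120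
    omega
  have hK1 := h.cardK_ge hP1
  have hK2 := h.cardK_le
  have hm40 : 40 < m := by
    by_contra hh
    have : Nat.card h.Pk * m ≤ 1024 * 40 := Nat.mul_le_mul hP (by omega)
    omega
  have h5 : 5 ∣ m := by
    obtain ⟨t, ht⟩ := hm
    have : t < 3 := by
      by_contra hh
      have : 41 * 3 ≤ m * t := Nat.mul_le_mul (by omega) (by omega)
      omega
    interval_cases t <;> omega
  haveI : Fact (Nat.Prime 5) := ⟨by norm_num⟩
  obtain ⟨g0, hg0⟩ := exists_prime_orderOf_dvd_card' (G := Subgroup.centralizer ({r} : Set G)) 5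
    (by rw [hD]; exact h5.mul_left _)
  obtain ⟨g, hgD⟩ := g0
  have hgr := memCent.1 hgD
  have hg5' : orderOf g = 5 := by rw [← hg0]; exact (Subgroup.orderOf_mk g hgD).symm
  have hg5 : g ^ 5 = 1 := by rw [← hg5']; exact pow_orderOf_eq_one g
  have hg1 : g ≠ 1 := by rintro rfl; simp at hg5'
  -- centralizer in C
  have hF := fix5 (R ⊓ Subgroup.centralizer {r}) g hg5 (by
    rintro x ⟨hx, hxr⟩
    exact ⟨h.Rn.conj_mem x hx g, memCent.2 (cmul (cmul hgr (memCent.1 hxr)) (cinv hgr))⟩)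
  have hFd := Subgroup.card_dvd_of_le (inf_le_left : (R ⊓ Subgroup.centralizer {r}) ⊓
    Subgroup.centralizer {g} ≤ _)
  have hWF : h.W ≤ (R ⊓ Subgroup.centralizer {r}) ⊓ Subgroup.centralizer {g} := by
    intro w hw
    exact ⟨h.W_le hw, memCent.2 (h.Wcomm hw hgr).symm⟩
  have hFW : (R ⊓ Subgroup.centralizer {r}) ⊓ Subgroup.centralizer {g} ≤ h.W := by
    by_cases h64 : Nat.card ((R ⊓ Subgroup.centralizer {r}) ⊓ Subgroup.centralizer {g} : Subgroup G) = 64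
    · exfalso
      have e := Subgroup.eq_of_le_of_card_ge (inf_le_left : (R ⊓ Subgroup.centralizer {r}) ⊓
        Subgroup.centralizer {g} ≤ _) (by rw [h64, h.cardC])
      have hcom : ∀ x ∈ R, x * r = r * x → x * g = g * x := by
        intro x hx hxr
        have : x ∈ (R ⊓ Subgroup.centralizer {r}) ⊓ Subgroup.centralizer {g} := by
          rw [e]; exact ⟨hx, memCent.2 hxr⟩
        exact memCent.1 this.2
      obtain ⟨⟨c, hc, hcr, hA⟩, ⟨c', hc', hcr', hA'⟩⟩ := h.lemM2 hgr (by
        intro x hx hxr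
        rw [← hcom x hx hxr, mul_inv_cancel_right, mul_inv_cancel]
        exact one_mem _)
      have p4 : ∀ c ∈ R, c * c * (c * c) = 1 := by
        intro c hc
        rcases h.sq c hc with e | e <;> rw [e]
        · simp
        · exact h.fr.zz
      have a1 := hA.mul' hA hcr
      have a1 := a1.mul' a1 (cmul hcr hcr)
      have hcr2 := (h.comm_zr c').2 hcr'
      have a2 := hA'.mul' hA' hcr2
      have a2 := a2.mul' a2 (cmul hcr2 hcr2)
      rw [p4 c hc] at a1
      rw [p4 c' hc'] at a2
      have g4 : g * g * (g * g) = 1 := h.ext2 a1 a2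
      apply hg1
      have : g ^ 5 = (g * g * (g * g)) * g := by simp only [pow_succ, pow_zero, one_mul, mul_assoc]
      rw [g4, one_mul, hg5] at this
      exact this.symm
    · have h4 : Nat.card ((R ⊓ Subgroup.centralizer {r}) ⊓ Subgroup.centralizer {g} : Subgroup G) = 4 := by
        rw [h.cardC] at hF hFd
        generalize Nat.card ((R ⊓ Subgroup.centralizer {r}) ⊓ Subgroup.centralizer {g} : Subgroup G) = n at *
        have hle := Nat.le_of_dvd (by norm_num) hFd
        unfold Nat.ModEq at hF
        interval_cases n <;> omega
      rw [← Subgroup.eq_of_le_of_card_ge hWF (by rw [h4, h.cardW])]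
  -- fixed points on K
  have hKf := fix5 (Kx ρ r) g hg5 (by
    rintro x ⟨hxr, hxA⟩
    refine ⟨cmul (cmul hgr hxr) (cinv hgr), ?_⟩
    have := ((Ag.rfl' (g := g)).mul' hxA (by simp)).mul' (Ag.rfl' (g := g⁻¹)) (cinv hgr)
    simpa using this)
  have hKfix : Kx ρ r ⊓ Subgroup.centralizer {g} = Subgroup.zpowers r := by
    apply le_antisymm
    · rintro k ⟨hk, hkg⟩
      have hkg := memCent.1 hkg
      obtain ⟨c, hc, hcr, hA⟩ := h.kc hk
      have hc2 := (h.comm_zr c).2 hcr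
      have hg2 := (h.comm_zr g).2 hgr
      have b1 : Ag ρ (z * r) (g * c * g⁻¹ * c⁻¹) 1 := by
        have e1 := (((Ag.rfl' (g := g)).mul' hA hc2).mul' (Ag.rfl' (g := g⁻¹)) (cinv hg2)).mul'
          (hA.inv' hc2) (cinv hc2)
        rw [← hkg, mul_inv_cancel_right, mul_inv_cancel] at e1
        exact e1.symm'
      have hu := h.fixC' (mul_mem (h.Rn.conj_mem c hc g) (inv_mem hc)) b1
      have hcg : c * g = g * c := by
        have hug : ∀ u, g * c * g⁻¹ * c⁻¹ = u → g * u = u * g → u * u = 1 → c * g = g * c := by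
          intro u e1 e2 e3
          have e4 : g * c = u * c * g := by rw [← e1]; group
          have e5 : (g * g) * c = c * (g * g) := by
            calc (g * g) * c = g * (g * c) := by group
              _ = (g * u) * (c * g) := by rw [e4]; group
              _ = u * (g * c) * g := by rw [e2]; group
              _ = (u * u) * (c * (g * g)) := by rw [e4]; group
              _ = c * (g * g) := by rw [e3, one_mul]
          have e6 : (g * g) * (g * g) * (g * g) = g := by
            have : (g * g) * (g * g) * (g * g) = g ^ 5 * g := by simp only [pow_succ, pow_zero, one_mul, mul_assoc]
            rw [this, hg5, one_mul]
          have e7 : Commute (g * g) c := e5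
          have e8 := (e7.mul_left e7).mul_left e7
          rw [e6] at e8
          exact e8.symm
        rcases hu with e | e
        · exact hug 1 e (by simp) (by simp)
        · exact hug (z * r) e hg2 h.swap.fr.rr
      have hcW := hFW ⟨⟨hc, memCent.2 hcr⟩, memCent.2 hcg⟩
      rcases h.Wk hk hA hcW with e | e <;> subst e
      · exact one_mem _
      · exact Subgroup.mem_zpowers _
    · rw [Subgroup.zpowers_le]
      exact ⟨h.r_mem, memCent.2 hgr.symm⟩
  have hor : orderOf r = 2 := orderOf_eq_prime (by rw [pow_two, h.fr.rr]) h.r1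
  rw [hKfix, Nat.card_zpowers, hor] at hKf
  have hpg : IsPGroup 2 (Kx ρ r) := by
    intro k
    refine ⟨2, ?_⟩
    apply Subtype.ext
    have : (k.1) ^ (2 ^ 2) = 1 := by
      have e : k.1 ^ (2 ^ 2) = (k.1 * k.1) * (k.1 * k.1) := by
        rw [show (2 : ℕ) ^ 2 = 4 by norm_num]; simp only [pow_succ, pow_zero, one_mul, mul_assoc]
      rw [e]
      rcases h.ksq k.2 with e | e <;> rw [e]
      · simp
      · exact h.fr.rr
    simpa using this
  obtain ⟨n, hn⟩ := hpg.exists_card_eq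
  rw [hn] at hKf hK1 hK2 ⊢
  have : n < 6 := by
    by_contra hh
    have : 2 ^ 6 ≤ 2 ^ n := Nat.pow_le_pow_right (by norm_num) (by omega)
    omega
  unfold Nat.ModEq at hKf
  interval_cases n <;> omega

end Ctx
end TD

section TE
set_option linter.unusedSectionVars false

/-- a criterion for a 2-group to be extraspecial -/
theorem extraspecial_of {K : Type*} [Group K] [Finite K] (t : K) (t1 : t ≠ 1) (ht : t * t = 1)
    (hc : ∀ x, x * t = t * x) (hsq : ∀ x : K, x * x = 1 ∨ x * x = t)
    (hcen : ∀ x : K, (∀ y, x * y = y * x) → x = 1 ∨ x = t)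
    (hK : ¬ ∀ x : K, x = 1 ∨ x = t) : IsExtraspecial 2 K := by
  have hor : orderOf t = 2 := orderOf_eq_prime (by rw [pow_two, ht]) t1
  have memT : ∀ x : K, x ∈ Subgroup.zpowers t ↔ x = 1 ∨ x = t := by
    intro x
    constructor
    · intro hx
      obtain ⟨n, rfl⟩ := Subgroup.mem_zpowers_iff.1 hx
      rcases Int.even_or_odd' n with ⟨k, rfl | rfl⟩
      · left; rw [zpow_mul, zpow_two, ht, one_zpow]
      · right; rw [zpow_add, zpow_mul, zpow_two, ht, one_zpow, one_mul, zpow_one]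
    · rintro (rfl | rfl)
      · exact one_mem _
      · exact Subgroup.mem_zpowers _
  have hpg : IsPGroup 2 K := by
    intro x
    refine ⟨2, ?_⟩
    have e : x ^ (2 ^ 2) = (x * x) * (x * x) := by
      rw [show (2 : ℕ) ^ 2 = 4 by norm_num]; simp only [pow_succ, pow_zero, one_mul, mul_assoc]
    rw [e]
    rcases hsq x with e | e <;> rw [e]
    · simp
    · exact ht
  have hcenter : Subgroup.center K = Subgroup.zpowers t := by
    apply le_antisymm
    · intro x hx
      rw [memT]
      exact hcen x fun y => (Subgroup.mem_center_iff.1 hx y).symm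
    · rw [Subgroup.zpowers_le, Subgroup.mem_center_iff]
      exact hc
  have hsqm : ∀ x : K, x * x ∈ Subgroup.zpowers t := fun x => (memT _).2 (hsq x)
  have htn : (Subgroup.zpowers t).Normal := by rw [← hcenter]; infer_instance
  have hcomm : ∀ x y : K, x * y * x⁻¹ * y⁻¹ ∈ Subgroup.zpowers t := by
    intro x y
    have : x * y * x⁻¹ * y⁻¹ = (x * y) * (x * y) * (y⁻¹ * ((x⁻¹ * x⁻¹)) * y⁻¹⁻¹) * (y⁻¹ * y⁻¹) := by
      group
    rw [this]
    exact mul_mem (mul_mem (hsqm _) (htn.conj_mem _ (hsqm _) _)) (hsqm _)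
  have hcomm_le : commutator K ≤ Subgroup.zpowers t := by
    rw [commutator_def, Subgroup.commutator_le]
    intro x _ y _
    exact hcomm x y
  have hcommutator : commutator K = Subgroup.zpowers t := by
    apply le_antisymm hcomm_le
    rw [Subgroup.zpowers_le]
    by_contra hn
    apply hK
    intro x
    apply hcen
    intro y
    have h1 : x * y * x⁻¹ * y⁻¹ ∈ commutator K :=
      Subgroup.commutator_mem_commutator (Subgroup.mem_top x) (Subgroup.mem_top y)
    rcases (memT _).1 (hcomm_le h1) with e | e
    · rw [mul_inv_eq_one, mul_inv_eq_iff_eq_mul] at e; exact e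
    · rw [e] at h1; exact absurd h1 hn
  have hfr_ge : Subgroup.zpowers t ≤ frattini K := by
    rw [← hcommutator]
    unfold frattini
    rw [Order.radical]
    refine le_iInf₂ ?_
    intro M hM
    rw [commutator_def, Subgroup.commutator_le]
    intro x _ y _
    change x * y * x⁻¹ * y⁻¹ ∈ M
    by_contra hxy
    -- t ∉ M, so M and t generate, K / M abelian
    have hxt : x * y * x⁻¹ * y⁻¹ = t := by
      rcases (memT _).1 (hcomm x y) with e | e
      · exact absurd (e ▸ one_mem M) hxy
      · exact e
    have htM : t ∉ M := by rw [← hxt]; exact hxy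
    have hlt : M < M ⊔ Subgroup.zpowers t := by
      refine lt_of_le_of_ne le_sup_left ?_
      intro e
      apply htM
      rw [e]
      exact Subgroup.mem_sup_right (Subgroup.mem_zpowers t)
    have htop := hM.2 _ hlt
    have dec : ∀ w : K, ∃ m ∈ M, ∃ u ∈ Subgroup.zpowers t, w = m * u := by
      intro w
      have hw : w ∈ M ⊔ Subgroup.zpowers t := by rw [htop]; trivial
      obtain ⟨m, hm, u, hu, e⟩ := Subgroup.mem_sup_of_normal_right.1 hw
      exact ⟨m, hm, u, hu, e.symm⟩
    obtain ⟨m, hm, u, hu, rfl⟩ := dec x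
    obtain ⟨n, hn, v, hv, rfl⟩ := dec y
    have ucen : ∀ u ∈ Subgroup.zpowers t, ∀ w : K, u * w = w * u := by
      intro u hu w
      rw [← hcenter] at hu
      exact (Subgroup.mem_center_iff.1 hu w).symm
    apply hxy
    have : m * u * (n * v) * (m * u)⁻¹ * (n * v)⁻¹ = m * n * m⁻¹ * n⁻¹ := by
      have hu' := ucen u hu
      have hv' := ucen v hv
      calc m * u * (n * v) * (m * u)⁻¹ * (n * v)⁻¹
          = m * (u * n) * v * u⁻¹ * m⁻¹ * v⁻¹ * n⁻¹ := by group
        _ = m * n * (u * v) * u⁻¹ * m⁻¹ * v⁻¹ * n⁻¹ := by rw [hu' n]; group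
        _ = m * n * (v * m⁻¹) * v⁻¹ * n⁻¹ := by rw [hu' v]; group
        _ = m * n * m⁻¹ * n⁻¹ := by rw [hv' m⁻¹]; group
    have h9 : m * u * (n * v) * (m * u)⁻¹ * (n * v)⁻¹ ∈ M := by
      rw [this]
      exact mul_mem (mul_mem (mul_mem hm hn) (inv_mem hm)) (inv_mem hn)
    exact h9
  have hfr_le : frattini K ≤ Subgroup.zpowers t := by
    intro g hg
    by_contra hgt
    obtain ⟨M, hM⟩ := (Set.toFinite {M : Subgroup K | Subgroup.zpowers t ≤ M ∧ g ∉ M}).exists_maximal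
      ⟨Subgroup.zpowers t, le_rfl, hgt⟩
    have hMt : Subgroup.zpowers t ≤ M := hM.1.1
    have hMg : g ∉ M := hM.1.2
    have hMn : M.Normal := by
      constructor
      intro n hn x
      have : x * n * x⁻¹ = (x * n * x⁻¹ * n⁻¹) * n := by group
      rw [this]
      exact mul_mem (hMt (hcomm x n)) hn
    have grow : ∀ x : K, x ∉ M → g ∈ M ⊔ Subgroup.zpowers x := by
      intro x hx
      by_contra hgx
      have := hM.2 (y := M ⊔ Subgroup.zpowers x) ⟨hMt.trans le_sup_left, hgx⟩ le_sup_left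
      exact hx (this (Subgroup.mem_sup_right (Subgroup.mem_zpowers x)))
    have two : ∀ x : K, ∀ u ∈ Subgroup.zpowers x, u ∈ M ∨ u * x⁻¹ ∈ M := by
      intro x u hu
      obtain ⟨n, rfl⟩ := Subgroup.mem_zpowers_iff.1 hu
      rcases Int.even_or_odd' n with ⟨k, rfl | rfl⟩
      · left; rw [zpow_mul, zpow_two]; exact zpow_mem (hMt (hsqm x)) k
      · right; rw [zpow_add, zpow_mul, zpow_two, zpow_one, mul_inv_cancel_right]
        exact zpow_mem (hMt (hsqm x)) k
    have hco : IsCoatom M := by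
      refine ⟨fun e => hMg (by rw [e]; trivial), ?_⟩
      intro N hN
      obtain ⟨x, hxN, hxM⟩ := SetLike.exists_of_lt hN
      have gx : ∀ x : K, x ∉ M → g * x⁻¹ ∈ M := by
        intro x hx
        obtain ⟨m, hm, u, hu, e⟩ := Subgroup.mem_sup_of_normal_left.1 (grow x hx)
        rcases two x u hu with h1 | h1
        · exact absurd (e ▸ mul_mem hm h1) hMg
        · rw [← e, mul_assoc]; exact mul_mem hm h1
      rw [eq_top_iff]
      intro y _
      have hgN : g ∈ N := by
        have := mul_mem (hN.le (gx x hxM)) hxN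
        simpa using this
      by_cases hy : y ∈ M
      · exact hN.le hy
      · have := mul_mem (inv_mem (hN.le (gx y hy))) hgN
        simpa using this
    exact hMg (frattini_le_coatom hco hg)
  refine ⟨hpg, by rw [hcenter, hcommutator], by rw [hcenter, le_antisymm hfr_le hfr_ge], ?_⟩
  rw [hcenter, Nat.card_zpowers, hor]

end TE

section TF
open Module
set_option linter.unusedSectionVars false

theorem mkES {E : Type*} [Group E] [Fintype E] (hE : IsExtraspecial 2 E)
    (hcard : Fintype.card E = 128)
    (hmin : ∀ A : Subgroup E, (∀ x ∈ A, x * x = 1) → Nat.card A ≤ 8) : ∃ z, ES E z := by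
  obtain ⟨-, hcc, -, h2⟩ := hE
  obtain ⟨u, w, huw, huniv⟩ := Nat.card_eq_two_iff.1 h2
  have hex : ∃ z ∈ Subgroup.center E, z ≠ 1 := by
    by_cases hu : u.1 = 1
    · refine ⟨w.1, w.2, fun hw => huw (Subtype.ext (hu.trans hw.symm))⟩
    · exact ⟨u.1, u.2, hu⟩
  obtain ⟨z, hz, z1⟩ := hex
  have hor : orderOf (⟨z, hz⟩ : Subgroup.center E) ∣ 2 := by rw [← h2]; exact orderOf_dvd_natCard _
  have zz : z * z = 1 := by
    have := orderOf_dvd_iff_pow_eq_one.1 hor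
    have := congrArg Subtype.val this
    rw [← pow_two]; simpa using this
  have hcen : ∀ x ∈ Subgroup.center E, x = 1 ∨ x = z := by
    intro x hx
    by_contra hne
    push Not at hne
    have h3 : ∀ y : Subgroup.center E, y = u ∨ y = w := by
      intro y
      have : y ∈ ({u, w} : Set (Subgroup.center E)) := by rw [huniv]; trivial
      simpa using this
    have n1 : (⟨x, hx⟩ : Subgroup.center E) ≠ 1 := fun e => hne.1 (congrArg Subtype.val e)
    have n2 : (⟨x, hx⟩ : Subgroup.center E) ≠ ⟨z, hz⟩ := fun e => hne.2 (congrArg Subtype.val e)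
    have n3 : (⟨z, hz⟩ : Subgroup.center E) ≠ 1 := fun e => z1 (congrArg Subtype.val e)
    rcases h3 ⟨x, hx⟩ with a | a <;> rcases h3 ⟨z, hz⟩ with b | b <;> rcases h3 1 with c | c <;>
      simp_all
  have zc : ∀ x, x * z = z * x := Subgroup.mem_center_iff.1 hz
  have cm : ∀ x y : E, x * y = y * x ∨ x * y = z * (y * x) := by
    intro x y
    have h1 : x * y * x⁻¹ * y⁻¹ ∈ Subgroup.center E := by
      rw [hcc]
      exact Subgroup.commutator_mem_commutator (Subgroup.mem_top x) (Subgroup.mem_top y)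
    rcases hcen _ h1 with e | e
    · left; rw [mul_inv_eq_one, mul_inv_eq_iff_eq_mul] at e; exact e
    · right
      rw [mul_inv_eq_iff_eq_mul, mul_inv_eq_iff_eq_mul] at e
      rw [e, mul_assoc]
  refine ⟨z, z1, zc, zz, ?_, cm, ?_, hcard, hmin⟩
  · intro x
    apply hcen
    rw [Subgroup.mem_center_iff]
    intro y
    rcases cm x y with e | e
    · rw [mul_assoc x, e, ← mul_assoc x, e, mul_assoc]
    · have : x * x * y = y * (x * x) := by
        rw [mul_assoc, e, ← mul_assoc, zc, mul_assoc, ← mul_assoc x, e, mul_assoc, ← mul_assoc z,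
          zz, one_mul, mul_assoc]
      exact this.symm
  · intro x hx
    apply hcen
    rw [Subgroup.mem_center_iff]
    exact fun y => (hx y).symm

theorem mkCtx {G V : Type*} [Group G] [Finite G] [AddCommGroup V] [Module (ZMod 3) V]
    [FiniteDimensional (ZMod 3) V]
    (R : Subgroup G) (ρ : G →* Module.End (ZMod 3) V) (r : G)
    (Rn : R.Normal) (hE : IsExtraspecial 2 R) (hcard : Nat.card R = 128)
    (hmin : ∀ A : Subgroup G, A ≤ R → (∀ x ∈ A, x * x = 1) → Nat.card A ≤ 8)
    (hG : 128 * 17496 ≤ Nat.card G) (hr : r ∈ R) (rr : r * r = 1)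
    (hrc : r ∉ Subgroup.centralizer (R : Set G)) (inj : Function.Injective ρ)
    (fd : finrank (ZMod 3) V = 8) : ∃ z a s i j s0, Ctx R ρ z r a s i j s0 := by
  classical
  haveI := Fintype.ofFinite R
  obtain ⟨z, h⟩ := mkES (E := R) hE (by rw [← Nat.card_eq_fintype_card, hcard]) (by
    intro A hA
    have := hmin (A.map R.subtype) (Subgroup.map_subtype_le A) (by
      rintro x ⟨y, hy, rfl⟩
      have := hA y hy
      rw [← map_mul, this, map_one])
    rwa [Subgroup.card_map_of_injective R.subtype_injective] at this)
  set r' : R := ⟨r, hr⟩ with hr'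
  have rr' : r' * r' = 1 := Subtype.ext rr
  have hz1 : r' ≠ 1 := by
    intro e
    apply hrc
    have e : r = 1 := congrArg Subtype.val e
    rw [e]; exact one_mem _
  have hzz : r' ≠ z := by
    intro e
    apply hrc
    rw [Subgroup.mem_centralizer_iff]
    intro t ht
    have := h.zc ⟨t, ht⟩
    rw [← e] at this
    exact congrArg Subtype.val this
  obtain ⟨a, s, i, j, ar, sr, ir, jr, aa, ii, jj, as, ij, ia, ja, is, js, aN⟩ := frame h rr' hz1 hzz
  obtain ⟨t, ht⟩ := noncentral h hz1 hzz
  have zcen : ∀ g : G, g * z = z * g := by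
    intro g
    have hm := Rn.conj_mem z.1 z.2 g
    rcases h.cen ⟨_, hm⟩ (by
      intro y
      apply Subtype.ext
      change g * z * g⁻¹ * y = y * (g * z * g⁻¹)
      have hm2 := Rn.conj_mem y.1 y.2 g⁻¹
      have e := h.zc ⟨_, hm2⟩
      have e : g⁻¹ * y * g⁻¹⁻¹ * z.1 = z.1 * (g⁻¹ * y * g⁻¹⁻¹) := congrArg Subtype.val e
      calc g * z * g⁻¹ * y = g * (z.1 * (g⁻¹ * y * g⁻¹⁻¹)) * g⁻¹ := by group
        _ = y * (g * z * g⁻¹) := by rw [← e]; group) with e | e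
    · exfalso
      have e : g * z * g⁻¹ = 1 := congrArg Subtype.val e
      apply h.z1
      apply Subtype.ext
      rw [mul_inv_eq_one] at e
      simpa using e
    · have e : g * z * g⁻¹ = z := congrArg Subtype.val e
      exact mul_inv_eq_iff_eq_mul.1 e
  have cv : ∀ {x y : R}, x = y → (x : G) = y := fun e => congrArg Subtype.val e
  have rz : r ≠ z := fun e => hzz (Subtype.ext e)
  have r1 : r ≠ 1 := fun e => hz1 (Subtype.ext e)
  have z1 : (z : G) ≠ 1 := fun e => h.z1 (Subtype.ext e)
  have memc : ∀ x : R, x ∈ cT ⊤ r' ↔ (x : G) * r = r * x := by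
    intro x
    rw [mem_cT]
    constructor
    · exact fun e => cv e.2
    · exact fun e => ⟨trivial, Subtype.ext e⟩
  have four : ∀ x : R, x ∈ ({1, z, r', z * r'} : Finset R) ↔
      ((x : G) = 1 ∨ (x : G) = z ∨ (x : G) = r ∨ (x : G) = z * r) := by
    intro x
    simp only [Finset.mem_insert, Finset.mem_singleton, Subtype.ext_iff]
    rfl
  refine ⟨z, a, s, i, j, t, ?_⟩
  exact
  { fr := {
      zr := zcen _
      za := zcen _
      zs := zcen _
      zi := zcen _
      zj := zcen _
      zs0 := zcen _
      zz := cv h.z2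
      rr := rr
      ra := cv ar
      rs := cv sr
      ri := cv ir
      rj := cv jr
      rs0 := cv ((h.cm r' t).resolve_left (fun e => ht e.symm))
      aa := cv aa
      ii := cv ii
      jj := cv jj
      as := cv as
      ij := cv ij
      ia := cv ia
      ja := cv ja
      is := cv is
      js := cv js }
    hz := z.2
    hr := hr
    ha := a.2
    hs := s.2
    hi := i.2
    hj := j.2
    Rn := Rn
    z1 := z1
    r1 := r1
    rz := rz
    zcen := zcen
    sq := fun x hx => (h.sq ⟨x, hx⟩).imp cv cv
    cm := fun x hx y hy => (h.cm ⟨x, hx⟩ ⟨y, hy⟩).imp cv cv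
    cenC := by
      intro x hx hh
      have := cen1' h (r := r') (x := ⟨x, hx⟩) rr' (by
        intro t ht
        exact Subtype.ext (hh t.1 t.2 ((memc t).1 ht)))
      exact (four ⟨x, hx⟩).1 (by convert this)
    cardC := by
      rw [← card_C1 h hz1 hzz]
      refine Nat.card_congr ⟨fun x => ⟨⟨x.1, x.2.1⟩, (memc _).2 (memCent.1 x.2.2)⟩,
        fun x => ⟨x.1.1, x.1.2, memCent.2 ((memc _).1 x.2)⟩, fun x => rfl, fun x => rfl⟩
    prods := by
      intro y hy hyr hyy
      obtain ⟨x, hx, hxx, hxy⟩ := prodsing h rr' hz1 hzz (y := ⟨y, hy⟩) ((memc _).2 hyr)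
        (Subtype.ext hyy)
      exact ⟨x, x.2, (memc _).1 hx, cv hxx, fun e => hxy (Subtype.ext e)⟩
    c24 := by
      rw [← count24 h rr' hz1 hzz]
      refine Nat.card_congr ⟨fun x => ⟨⟨x.1, x.2.1.1⟩, (memc _).2 (memCent.1 x.2.1.2),
        Subtype.ext x.2.2⟩,
        fun x => ⟨x.1.1, ⟨x.1.2, memCent.2 ((memc _).1 x.2.1)⟩, cv x.2.2⟩, fun x => rfl, fun x => rfl⟩
    cardD := by
      have hS : ({x : R | x * x = 1}).ncard = 56 := count56 h rr' hz1 hzz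
      have h2 : ({1, z} : Set R).ncard = 2 := Set.ncard_pair h.z1.symm
      have hsub : ({1, z} : Set R) ⊆ {x : R | x * x = 1} := by
        rintro x (rfl | rfl)
        · simp
        · exact h.z2
      have h3 := Set.ncard_sdiff hsub (Set.toFinite _)
      have h4 : (Subgroup.centralizer ({r} : Set G)).index ≤ 54 := by
        have h54 : Nat.card ({x : R | x * x = 1} \ {1, z} : Set R) = 54 := by
          rw [Nat.card_coe_set_eq, h3, hS, h2]
        rw [← h54]
        let f : (G ⧸ Subgroup.centralizer ({r} : Set G)) → ({x : R | x * x = 1} \ {1, z} : Set R) :=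
          fun q => ⟨⟨q.out * r * q.out⁻¹, Rn.conj_mem r hr _⟩, by
            constructor
            · apply Subtype.ext
              change q.out * r * q.out⁻¹ * (q.out * r * q.out⁻¹) = 1
              have : q.out * r * q.out⁻¹ * (q.out * r * q.out⁻¹) = q.out * (r * r) * q.out⁻¹ := by group
              rw [this, rr]; group
            · rintro (e | e)
              · have e : q.out * r * q.out⁻¹ = 1 := cv e
                rw [mul_inv_eq_one] at e
                exact r1 (by simpa using e)
              · have e : q.out * r * q.out⁻¹ = z := cv e
                rw [mul_inv_eq_iff_eq_mul, ← zcen] at e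
                exact rz (mul_left_cancel e)⟩
        refine Nat.card_le_card_of_injective f ?_
        intro q q' e
        have e : q.out * r * q.out⁻¹ = q'.out * r * q'.out⁻¹ := cv (congrArg Subtype.val e)
        rw [← q.out_eq, ← q'.out_eq]
        refine QuotientGroup.eq.2 (memCent.2 ?_)
        have : q'.out * r = q.out * r * q.out⁻¹ * q'.out := by rw [e]; group
        rw [mul_assoc, this]; group
      have h5 := Subgroup.card_mul_index (Subgroup.centralizer ({r} : Set G))
      have h6 : Nat.card (Subgroup.centralizer ({r} : Set G)) * (Subgroup.centralizer ({r} : Set G)).index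
        ≤ Nat.card (Subgroup.centralizer ({r} : Set G)) * 54 := Nat.mul_le_mul_left _ h4
      omega
    inj := inj
    fd := fd
    mini := hmin
    aN := by
      have : ¬ a ∈ ({1, z, r', z * r'} : Finset R) := by convert aN
      rw [four] at this
      push Not at this
      exact this }

end TF

section TG
open Module
set_option linter.unusedSectionVars false

theorem exRho.{u} {H : Type u} [Group H] [Finite H] (Q : Subgroup H) [Q.Normal]
    (hcc : Subgroup.center Q = commutator Q) (hcard : Nat.card Q = 3 ^ 9)
    (hcc3 : Nat.card (Subgroup.center Q) = 3) (hexp : ∀ x ∈ Q, x ^ 3 = 1) :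
    ∃ (V : Type u) (_ : AddCommGroup V) (_ : Module (ZMod 3) V) (_ : FiniteDimensional (ZMod 3) V)
      (π : Q → V) (ρ : (H ⧸ Q) →* Module.End (ZMod 3) V), finrank (ZMod 3) V = 8 ∧
      Function.Surjective π ∧ (∀ x y, π x = π y ↔ x⁻¹ * y ∈ Subgroup.center Q) ∧
      (∀ (h : H) (x : Q), ρ (h : H ⧸ Q) (π x) = π (MulAut.conjNormal h x)) := by
  letI : CommGroup (Q ⧸ Subgroup.center Q) :=
    { (inferInstance : Group (Q ⧸ Subgroup.center Q)) with
      mul_comm := by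
        intro x y
        obtain ⟨x, rfl⟩ := QuotientGroup.mk_surjective x
        obtain ⟨y, rfl⟩ := QuotientGroup.mk_surjective y
        rw [← QuotientGroup.mk_mul, ← QuotientGroup.mk_mul, QuotientGroup.eq, hcc]
        have : (x * y)⁻¹ * (y * x) = y⁻¹ * x⁻¹ * y⁻¹⁻¹ * x⁻¹⁻¹ := by group
        rw [this]
        exact Subgroup.commutator_mem_commutator (Subgroup.mem_top _) (Subgroup.mem_top _) }
  letI : Module (ZMod 3) (Additive (Q ⧸ Subgroup.center Q)) := AddCommGroup.zmodModule (by
    intro x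
    obtain ⟨x, rfl⟩ := Additive.ofMul.surjective x
    obtain ⟨x, rfl⟩ := QuotientGroup.mk_surjective x
    rw [← ofMul_pow, ← QuotientGroup.mk_pow]
    have : x ^ 3 = 1 := Subtype.ext (by simpa using hexp x x.2)
    rw [this]; rfl)
  let f : H → (Q ⧸ Subgroup.center Q) →* (Q ⧸ Subgroup.center Q) := fun h =>
    QuotientGroup.map _ _ (MulAut.conjNormal h : MulAut Q).toMonoidHom (by
      intro x hx
      rw [Subgroup.mem_comap]
      have hch : (Subgroup.center Q).Characteristic := inferInstance
      have := hch.fixed (MulAut.conjNormal h : MulAut Q)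
      rw [← this] at hx
      exact hx)
  have hf : ∀ h (x : Q), f h (x : Q ⧸ Subgroup.center Q) = ((MulAut.conjNormal h x : Q) : Q ⧸ Subgroup.center Q) :=
    fun h x => rfl
  let ρ0 : H →* Module.End (ZMod 3) (Additive (Q ⧸ Subgroup.center Q)) :=
    { toFun := fun h => (MonoidHom.toAdditive (f h)).toZModLinearMap 3
      map_one' := by
        ext x
        obtain ⟨x, rfl⟩ := Additive.ofMul.surjective x
        obtain ⟨x, rfl⟩ := QuotientGroup.mk_surjective x
        change Additive.ofMul (f 1 (x : Q ⧸ Subgroup.center Q)) = Additive.ofMul (x : Q ⧸ Subgroup.center Q)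
        rw [hf, map_one]; rfl
      map_mul' := by
        intro g h
        ext x
        obtain ⟨x, rfl⟩ := Additive.ofMul.surjective x
        obtain ⟨x, rfl⟩ := QuotientGroup.mk_surjective x
        change Additive.ofMul (f (g * h) (x : Q ⧸ Subgroup.center Q)) =
          Additive.ofMul (f g (f h (x : Q ⧸ Subgroup.center Q)))
        rw [hf, hf, hf, map_mul]; rfl }
  have hρ0 : ∀ h (x : Q), ρ0 h (Additive.ofMul (x : Q ⧸ Subgroup.center Q)) =
      Additive.ofMul ((MulAut.conjNormal h x : Q) : Q ⧸ Subgroup.center Q) := fun h x => rfl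
  have hker : Q ≤ ρ0.ker := by
    intro q hq
    rw [MonoidHom.mem_ker]
    ext x
    obtain ⟨x, rfl⟩ := Additive.ofMul.surjective x
    obtain ⟨x, rfl⟩ := QuotientGroup.mk_surjective x
    rw [hρ0]
    have e : (MulAut.conjNormal q x : Q) = ⟨q, hq⟩ * x * (⟨q, hq⟩ : Q)⁻¹ := Subtype.ext (by simp)
    have key : ((MulAut.conjNormal q x : Q) : Q ⧸ Subgroup.center Q) = (x : Q ⧸ Subgroup.center Q) := by
      rw [e, QuotientGroup.mk_mul, QuotientGroup.mk_mul, QuotientGroup.mk_inv,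
        mul_comm ((⟨q, hq⟩ : Q) : Q ⧸ Subgroup.center Q), mul_inv_cancel_right]
    exact congrArg Additive.ofMul key
  refine ⟨Additive (Q ⧸ Subgroup.center Q), inferInstance, inferInstance, ?_,
    fun x => Additive.ofMul (x : Q ⧸ Subgroup.center Q), QuotientGroup.lift Q ρ0 hker, ?_, ?_, ?_, ?_⟩
  · haveI : Finite (Additive (Q ⧸ Subgroup.center Q)) :=
      inferInstanceAs (Finite (Q ⧸ Subgroup.center Q))
    exact Module.Finite.of_finite
  · haveI : Finite (Additive (Q ⧸ Subgroup.center Q)) :=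
      inferInstanceAs (Finite (Q ⧸ Subgroup.center Q))
    have h1 := Module.natCard_eq_pow_finrank (K := ZMod 3) (V := Additive (Q ⧸ Subgroup.center Q))
    have h2 : Nat.card (Additive (Q ⧸ Subgroup.center Q)) = 3 ^ 8 := by
      have h3 := Subgroup.card_eq_card_quotient_mul_card_subgroup (Subgroup.center Q)
      have h4 : Nat.card (Additive (Q ⧸ Subgroup.center Q)) = Nat.card (Q ⧸ Subgroup.center Q) := rfl
      rw [hcard, hcc3] at h3
      omega
    rw [h2, Nat.card_zmod] at h1
    exact (Nat.pow_right_injective (by norm_num) h1).symm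
  · intro x
    obtain ⟨x, rfl⟩ := Additive.ofMul.surjective x
    obtain ⟨x, rfl⟩ := QuotientGroup.mk_surjective x
    exact ⟨x, rfl⟩
  · intro x y
    rw [← QuotientGroup.eq]
    exact Additive.ofMul.injective.eq_iff
  · intro h x
    exact hρ0 h x

end TG

section TH
open Module
set_option linter.unusedSectionVars false

theorem eq_one_of_pows {G : Type*} [Group G] {x : G} (h3 : x ^ 3 = 1) (h2 : x ^ 128 = 1) : x = 1 := by
  have : x ^ 129 = 1 := by rw [show 129 = 3 * 43 by norm_num, pow_mul, h3, one_pow]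
  rwa [pow_succ, h2, one_mul] at this

/-- the facts about `H / Q` that are needed for the transfer to `H` -/
theorem dataK {H : Type*} [Group H] [Finite H] (Q : Subgroup H) [Q.Normal]
    (hH : SimilarToF2Centralizer H Q) (r : H) (hr : orderOf r = 2)
    (hrO2 : (r : H ⧸ Q) ∈ Op 2 (H ⧸ Q))
    (hrnc : (r : H ⧸ Q) ∉ Subgroup.centralizer ((Op 2 (H ⧸ Q)) : Set (H ⧸ Q))) :
    ∃ K : Subgroup (H ⧸ Q),
      (∀ h : H, (h : H ⧸ Q) ∈ K ↔ ((h : H ⧸ Q) * (r : H ⧸ Q) = (r : H ⧸ Q) * (h : H ⧸ Q)) ∧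
        ∀ q ∈ Q, r * q * r⁻¹ * q⁻¹ ∈ Subgroup.center H → h * q * h⁻¹ * q⁻¹ ∈ Subgroup.center H) ∧
      (r : H ⧸ Q) ∈ K ∧ Nat.card K = 32 ∧
      (∀ k ∈ K, k * k = 1 ∨ k * k = (r : H ⧸ Q)) ∧
      (∀ k ∈ K, (∀ x ∈ K, k * x = x * k) → k = 1 ∨ k = (r : H ⧸ Q)) ∧
      (∀ A : Subgroup (H ⧸ Q), A ≤ K → (∀ x ∈ A, x * x = 1) → Nat.card A ≤ 4) ∧
      ∃ k ∈ K, k * k = 1 ∧ k ≠ 1 ∧ k ≠ (r : H ⧸ Q) := by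
  obtain ⟨-, hcc, -, hc3⟩ := hH.extraspecial
  have hcen : ∀ x : Q, x ∈ Subgroup.center Q ↔ (x : H) ∈ Subgroup.center H := by
    intro x
    rw [← hH.centralizer_eq, Subgroup.mem_center_iff, Subgroup.mem_centralizer_iff]
    constructor
    · intro h y hy
      exact congrArg Subtype.val (h ⟨y, hy⟩)
    · intro h y
      exact Subtype.ext (h y y.2)
  obtain ⟨V, _, _, _, π, ρ, fd, πs, πe, hρ⟩ := exRho Q hcc hH.card_eq hc3 hH.exponent3
  have hact : ∀ (h : H) (x : Q), ρ (h : H ⧸ Q) (π x) = π x ↔ h * x * h⁻¹ * (x : H)⁻¹ ∈ Subgroup.center H := by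
    intro h x
    rw [hρ, πe, hcen, ← Subgroup.inv_mem_iff]
    have : ((((MulAut.conjNormal h x : Q)⁻¹ * x : Q) : H))⁻¹ = (x : H)⁻¹ * (h * x * h⁻¹) := by simp [mul_assoc]
    rw [this]
    constructor
    · intro hm
      have e := Subgroup.mem_center_iff.1 hm x
      rw [mul_inv_cancel_left] at e
      rw [e, mul_inv_cancel_right]
      exact hm
    · intro hm
      have e := Subgroup.mem_center_iff.1 hm (x : H)⁻¹
      have e2 : (x : H)⁻¹ * (h * x * h⁻¹) = h * x * h⁻¹ * (x : H)⁻¹ := by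
        have := congrArg (· * (x : H)) e
        simp only [mul_assoc, inv_mul_cancel, mul_one] at this
        simp only [mul_assoc]
        exact this
      rw [e2]; exact hm
  have hR128 : ∀ x ∈ Op 2 (H ⧸ Q), x ^ 128 = 1 := by
    intro x hx
    have h1 : (⟨x, hx⟩ : Op 2 (H ⧸ Q)) ^ Nat.card (Op 2 (H ⧸ Q)) = 1 := pow_card_eq_one'
    rw [hH.O2_card] at h1
    have := congrArg Subtype.val h1
    simpa using this
  have inj : Function.Injective ρ := by
    rw [injective_iff_map_eq_one]
    have cube : ∀ n : H ⧸ Q, ρ n = 1 → n ^ 3 = 1 := by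
      intro n hn
      obtain ⟨n, rfl⟩ := QuotientGroup.mk_surjective n
      rw [← QuotientGroup.mk_pow, QuotientGroup.eq_one_iff]
      apply hH.center_le
      rw [← hH.centralizer_eq, Subgroup.mem_centralizer_iff]
      intro q hq
      have h1 := (hact n ⟨q, hq⟩).1 (by rw [hn]; rfl)
      simp only at h1
      set ζ := n * q * n⁻¹ * q⁻¹ with hζ
      have hζc := Subgroup.mem_center_iff.1 h1
      have e1 : n * q = ζ * q * n := by rw [hζ]; group
      have hζ3 : ζ ^ 3 = 1 := hH.exponent3 _ (hH.center_le h1)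
      have e2 : n ^ 3 * q = ζ ^ 3 * (q * n ^ 3) := by
        calc n ^ 3 * q = n * (n * (n * q)) := by simp only [pow_succ, pow_zero, one_mul, mul_assoc]
          _ = n * ((n * ζ) * q * n) := by rw [e1]; simp only [mul_assoc]
          _ = n * (ζ * (n * q) * n) := by rw [hζc]; simp only [mul_assoc]
          _ = (n * ζ) * ζ * (q * n * n) := by rw [e1]; simp only [mul_assoc]
          _ = ζ * (n * ζ) * (q * n * n) := by rw [hζc]
          _ = ζ * ζ * (n * q) * n * n := by rw [hζc]; simp only [mul_assoc]
          _ = ζ ^ 3 * (q * n ^ 3) := by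
            rw [e1]; simp only [pow_succ, pow_zero, one_mul, mul_assoc]
      rw [e2, hζ3, one_mul]
    intro n hn
    have hnc : n ∈ Op 2 (H ⧸ Q) := by
      apply hH.O2_selfCentralizing
      rw [Subgroup.mem_centralizer_iff]
      intro x hx
      have hm : n * x * n⁻¹ * x⁻¹ ∈ Op 2 (H ⧸ Q) :=
        mul_mem ((Op.normal 2 (H ⧸ Q)).conj_mem x hx n) (inv_mem hx)
      have hk : ρ (n * x * n⁻¹ * x⁻¹) = 1 := by
        have : n⁻¹ ∈ ρ.ker := inv_mem hn
        have h1 : ρ n⁻¹ = 1 := this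
        rw [map_mul, map_mul, map_mul, hn, h1, one_mul, mul_one, ← map_mul, mul_inv_cancel, map_one]
      have := eq_one_of_pows (cube _ hk) (hR128 _ hm)
      rw [mul_inv_eq_one, mul_inv_eq_iff_eq_mul] at this
      exact this.symm
    exact eq_one_of_pows (cube _ hn) (hR128 _ hnc)
  have rr : r * r = 1 := by rw [← pow_two, ← hr]; exact pow_orderOf_eq_one r
  obtain ⟨z, a, s, i, j, s0, h⟩ := mkCtx (Op 2 (H ⧸ Q)) ρ (r : H ⧸ Q) inferInstance
    hH.O2_extraspecial hH.O2_card
    (fun A hA hx => hH.O2_minusType A hA (fun x hxA => by rw [pow_two]; exact hx x hxA))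
    (by
      obtain ⟨e⟩ := hH.quotient_iso
      rw [Subgroup.card_eq_card_quotient_mul_card_subgroup (Op 2 (H ⧸ Q)), hH.O2_card,
        Nat.card_congr e.toEquiv]
      have := card_PSp43_ge
      omega)
    hrO2 (by rw [← QuotientGroup.mk_mul, rr]; rfl) hrnc inj fd
  refine ⟨Kx ρ (r : H ⧸ Q), ?_, h.r_mem, h.cardK, fun k hk => h.ksq hk,
    fun k hk hx => h.cenK h.cardK hk hx, h.elA, h.exA h.cardK⟩
  intro g
  rw [mem_Kx]
  refine and_congr_right fun _ => ?_
  constructor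
  · intro hA q hq hrq
    rw [← hact g ⟨q, hq⟩]
    rw [hA _ ((hact r ⟨q, hq⟩).2 hrq), rho_one']
  · intro hA v hv
    obtain ⟨x, rfl⟩ := πs v
    rw [rho_one', hact]
    exact hA x x.2 ((hact r x).1 hv)

end TH

section TI
set_option linter.unusedSectionVars false

/-- transfer of the data about `H / Q` to the centralizer of `r` in `H` -/
theorem existsL {H : Type*} [Group H] [Finite H] (Q : Subgroup H) [Q.Normal] (r : H) (rr : r * r = 1)
    (r1 : r ≠ 1) (x3 : ∀ x ∈ Q, x ^ 3 = 1) (ZQ : Subgroup.center H ≤ Q)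
    (cQ : ∀ x : H, (∀ q ∈ Q, x * q = q * x) → x ∈ Subgroup.center H)
    (comQ : ∀ x ∈ Q, ∀ y ∈ Q, x * y * x⁻¹ * y⁻¹ ∈ Subgroup.center H)
    (K : Subgroup (H ⧸ Q))
    (hK : ∀ h : H, (h : H ⧸ Q) ∈ K ↔ ((h : H ⧸ Q) * (r : H ⧸ Q) = (r : H ⧸ Q) * (h : H ⧸ Q)) ∧
        ∀ q ∈ Q, r * q * r⁻¹ * q⁻¹ ∈ Subgroup.center H → h * q * h⁻¹ * q⁻¹ ∈ Subgroup.center H)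
    (hsqK : ∀ k ∈ K, k * k = 1 ∨ k * k = (r : H ⧸ Q)) :
    ∃ L : Subgroup H,
      (∀ y, y ∈ L ↔ y * r = r * y ∧ (∀ q ∈ Q, q * r = r * q → y * q = q * y) ∧ y ^ 4 = 1) ∧
      (∀ y ∈ L, (y : H ⧸ Q) ∈ K) ∧ (∀ y ∈ L, y * y = 1 ∨ y * y = r) ∧
      (∀ k ∈ K, ∃ y ∈ L, (y : H ⧸ Q) = k) ∧ (∀ y ∈ L, (y : H ⧸ Q) = 1 → y = 1) ∧ r ∈ L ∧
      (∀ I : Subgroup H, I ≤ Subgroup.centralizer {r} → Nat.Coprime (Nat.card I) 3 →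
        (∀ w ∈ Q ⊓ Subgroup.centralizer {r}, ∀ x ∈ I, w * x * w⁻¹ ∈ I) → I ≤ L) := by
  have rinv : r⁻¹ = r := inv_eq_of_mul_eq_one_left rr
  have zc : ∀ z ∈ Subgroup.center H, ∀ g, g * z = z * g := fun z hz g => Subgroup.mem_center_iff.1 hz g
  have z1 : ∀ z ∈ Q, z * z = 1 → z = 1 := by
    intro z hz h
    have h3 := x3 z hz
    rwa [pow_succ, pow_two, h, one_mul] at h3
  have fixC : ∀ q ∈ Q, r * q * r⁻¹ * q⁻¹ ∈ Subgroup.center H → q * r = r * q := by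
    intro q hq hz
    set ζ := r * q * r⁻¹ * q⁻¹ with hζ
    have e1 : r * q = ζ * q * r := by rw [hζ]; group
    have e2 : q = ζ * ζ * q := by
      calc q = (r * r) * q := by rw [rr, one_mul]
        _ = r * (r * q) := by rw [mul_assoc]
        _ = (r * ζ) * q * r := by rw [e1]; simp only [mul_assoc]
        _ = ζ * (r * q) * r := by rw [zc ζ hz r]; simp only [mul_assoc]
        _ = ζ * ζ * q * (r * r) := by rw [e1]; simp only [mul_assoc]
        _ = ζ * ζ * q := by rw [rr, mul_one]
    have e3 : ζ * ζ = 1 := by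
      have := congrArg (· * q⁻¹) e2
      simpa using this.symm
    have e4 := z1 ζ (ZQ hz) e3
    rw [e1, e4, one_mul]
  have lift : ∀ x : H, (x : H ⧸ Q) * (r : H ⧸ Q) = (r : H ⧸ Q) * (x : H ⧸ Q) →
      ∃ h : H, h * r = r * h ∧ (h : H ⧸ Q) = (x : H ⧸ Q) := by
    intro x hx
    set q := r * x⁻¹ * r * x with hq
    have hqQ : q ∈ Q := by
      rw [← QuotientGroup.eq_one_iff, hq]
      have : ((r * x⁻¹ * r * x : H) : H ⧸ Q) =
        (r : H ⧸ Q) * (x : H ⧸ Q)⁻¹ * ((r : H ⧸ Q) * (x : H ⧸ Q)) := by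
        simp only [QuotientGroup.mk_mul, QuotientGroup.mk_inv, mul_assoc]
      rw [this, ← hx]
      simp only [mul_assoc, inv_mul_cancel_left]
      rw [← QuotientGroup.mk_mul, rr]; rfl
    have hq3 := x3 q hqQ
    have e1 : r * q * r * q = 1 := by
      rw [hq]
      calc r * (r * x⁻¹ * r * x) * r * (r * x⁻¹ * r * x)
          = (r * r) * x⁻¹ * r * x * (r * r) * x⁻¹ * r * x := by simp only [mul_assoc]
        _ = x⁻¹ * (r * r) * x := by rw [rr]; simp [mul_assoc]; rw [← mul_assoc r, rr]; simp
        _ = 1 := by rw [rr]; simp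
    have e2 : r * q * r = q⁻¹ := eq_inv_of_mul_eq_one_left e1
    refine ⟨x * q, ?_, ?_⟩
    · have e3 : x * (r * q) = r * x := by
        rw [hq]
        calc x * (r * (r * x⁻¹ * r * x)) = x * (r * r) * x⁻¹ * r * x := by simp only [mul_assoc]
          _ = r * x := by rw [rr]; simp
      have e4 : q * r = r * q⁻¹ := by
        rw [← e2]
        calc q * r = (r * r) * q * r := by rw [rr, one_mul]
          _ = _ := by simp only [mul_assoc]
      have e5 : q⁻¹ = q * q := by
        rw [inv_eq_iff_mul_eq_one, ← mul_assoc]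
        rwa [pow_succ, pow_two] at hq3
      calc x * q * r = x * (q * r) := by rw [mul_assoc]
        _ = x * (r * q) * q := by rw [e4, e5]; simp only [mul_assoc]
        _ = r * (x * q) := by rw [e3, mul_assoc]
    · rw [QuotientGroup.mk_mul, (QuotientGroup.eq_one_iff q).2 hqQ, mul_one]
  have YQ : ∀ y ∈ Q, y * r = r * y → (∀ q ∈ Q, q * r = r * q → y * q = q * y) →
      y ∈ Subgroup.center H := by
    intro y hy yr hc
    apply cQ
    intro q hq
    have hq' : r * q * r⁻¹ ∈ Q := Subgroup.Normal.conj_mem inferInstance q hq r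
    set q' := r * q * r⁻¹ with hq'd
    have hrq : r * q = q' * r := by rw [hq'd]; group
    have hrq' : r * q' = q * r := by
      rw [hq'd, rinv, ← mul_assoc, ← mul_assoc, rr, one_mul]
    have ht : q * q' ∈ Q := mul_mem hq hq'
    have htr : (q * q') * r = r * (q * q') := by
      apply fixC _ ht
      have : r * (q * q') * r⁻¹ * (q * q')⁻¹ = q' * q * q'⁻¹ * q⁻¹ := by
        rw [← mul_assoc, hrq, mul_assoc q', hrq']; group
      rw [this]
      exact comQ _ hq' _ hq
    have yt := hc _ ht htr
    have cz := comQ y hy q hq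
    set c := y * q * y⁻¹ * q⁻¹ with hcd
    have e1 : y * q = c * q * y := by rw [hcd]; group
    have e2 : y * q' = c * q' * y := by
      calc y * q' = (y * r) * q * r⁻¹ := by rw [hq'd]; simp only [mul_assoc]
        _ = r * (y * q) * r⁻¹ := by rw [yr]; simp only [mul_assoc]
        _ = (r * c) * q * (y * r⁻¹) := by rw [e1]; simp only [mul_assoc]
        _ = c * (r * q * r⁻¹) * y := by rw [zc c cz, rinv, yr]; simp only [mul_assoc]
    have e3 : q * q' * y = c * c * (q * q' * y) := by
      calc q * q' * y = (y * q) * q' := by rw [← yt, mul_assoc]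
        _ = c * q * (y * q') := by rw [e1]; simp only [mul_assoc]
        _ = c * (q * c) * q' * y := by rw [e2]; simp only [mul_assoc]
        _ = _ := by rw [zc c cz]; simp only [mul_assoc]
    have e4 : c * c = 1 := by
      have := e3.symm
      rwa [mul_eq_right] at this
    rw [e1, z1 c (ZQ cz) e4, one_mul]
  have YK : ∀ y, y * r = r * y → (∀ q ∈ Q, q * r = r * q → y * q = q * y) → (y : H ⧸ Q) ∈ K := by
    intro y yr hc
    refine (hK y).2 ⟨by rw [← QuotientGroup.mk_mul, yr]; rfl, fun q hq hz => ?_⟩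
    rw [hc q hq (fixC q hq hz)]
    simp
  have Ymul : ∀ x y : H, (∀ q ∈ Q, q * r = r * q → x * q = q * x) →
      (∀ q ∈ Q, q * r = r * q → y * q = q * y) → (∀ q ∈ Q, q * r = r * q → (x * y) * q = q * (x * y)) :=
    fun x y hx hy q hq hqr => by rw [mul_assoc, hy q hq hqr, ← mul_assoc, hx q hq hqr, mul_assoc]
  have rY : ∀ q ∈ Q, q * r = r * q → r * q = q * r := fun q _ h => h.symm
  have four : ∀ k ∈ K, k ^ 4 = 1 := by
    intro k hk
    have e : k ^ 4 = (k * k) * (k * k) := by simp only [pow_succ, pow_zero, one_mul, mul_assoc]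
    rw [e]
    rcases hsqK k hk with h | h
    · rw [h, one_mul]
    · rw [h, ← QuotientGroup.mk_mul, rr]; rfl
  have Y4 : ∀ y, y * r = r * y → (∀ q ∈ Q, q * r = r * q → y * q = q * y) → y ^ 4 ∈ Subgroup.center H := by
    intro y yr hc
    have y4 : y ^ 4 = (y * y) * (y * y) := by simp only [pow_succ, pow_zero, one_mul, mul_assoc]
    apply YQ
    · rw [← QuotientGroup.eq_one_iff, QuotientGroup.mk_pow]
      exact four _ (YK y yr hc)
    · rw [y4]; exact cmul (cmul yr yr) (cmul yr yr)
    · rw [y4]; exact Ymul _ _ (Ymul _ _ hc hc) (Ymul _ _ hc hc)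
  have Ysq : ∀ y, y * r = r * y → (∀ q ∈ Q, q * r = r * q → y * q = q * y) →
      ∃ ζ ∈ Subgroup.center H, ∃ s, (s = 1 ∨ s = r) ∧ y * y = ζ * s := by
    intro y yr hc
    rcases hsqK _ (YK y yr hc) with h | h
    · refine ⟨y * y, YQ _ ?_ (cmul yr yr) (Ymul _ _ hc hc), 1, Or.inl rfl, by rw [mul_one]⟩
      rw [← QuotientGroup.eq_one_iff, QuotientGroup.mk_mul]; exact h
    · refine ⟨y * y * r, YQ _ ?_ (cmul (cmul yr yr) rfl) (Ymul _ _ (Ymul _ _ hc hc) rY), r, Or.inr rfl, by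
        rw [mul_assoc, rr, mul_one]⟩
      rw [← QuotientGroup.eq_one_iff, QuotientGroup.mk_mul, QuotientGroup.mk_mul, h,
        ← QuotientGroup.mk_mul, rr]
      rfl
  have Lsq : ∀ y, y * r = r * y → (∀ q ∈ Q, q * r = r * q → y * q = q * y) → y ^ 4 = 1 →
      (y * y = 1 ∨ y * y = r) := by
    intro y yr hc y4
    obtain ⟨ζ, hζ, s, hs, e⟩ := Ysq y yr hc
    have ss : s * s = 1 := by rcases hs with rfl | rfl; exacts [one_mul 1, rr]
    have : ζ * ζ = 1 := by
      have h4 : y ^ 4 = (y * y) * (y * y) := by simp only [pow_succ, pow_zero, one_mul, mul_assoc]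
      rw [h4, e, mul_assoc, ← mul_assoc s, zc ζ hζ s, mul_assoc ζ s s, ss, mul_one] at y4
      exact y4
    rw [z1 ζ (ZQ hζ) this, one_mul] at e
    rw [e]; exact hs
  let L : Subgroup H :=
    { carrier := {y | y * r = r * y ∧ (∀ q ∈ Q, q * r = r * q → y * q = q * y) ∧ y ^ 4 = 1}
      one_mem' := ⟨by simp, by simp, by simp⟩
      inv_mem' := by
        rintro y ⟨h1, h2, h3⟩
        refine ⟨cinv h1, fun q hq hqr => cinv (h2 q hq hqr), by rw [inv_pow, h3, inv_one]⟩
      mul_mem' := by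
        rintro x y ⟨x1, x2, x4⟩ ⟨y1, y2, y4⟩
        refine ⟨cmul x1 y1, Ymul _ _ x2 y2, ?_⟩
        obtain ⟨ζ, hζ, s, hs, e⟩ := Ysq (x * y) (cmul x1 y1) (Ymul _ _ x2 y2)
        have hs1 : ∃ s1, (s1 = 1 ∨ s1 = r) ∧ x * x = s1 := ⟨_, Lsq x x1 x2 x4, rfl⟩
        have hs2 : ∃ s2, (s2 = 1 ∨ s2 = r) ∧ y * y = s2 := ⟨_, Lsq y y1 y2 y4, rfl⟩
        obtain ⟨s1, hs1, es1⟩ := hs1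
        obtain ⟨s2, hs2, es2⟩ := hs2
        have sc : ∀ s, (s = 1 ∨ s = r) → ∀ g : H, g * r = r * g → g * s = s * g := by
          rintro s (rfl | rfl) g hg
          · simp
          · exact hg
        have sq : ∀ s, (s = 1 ∨ s = r) → s * s = 1 := by
          rintro s (rfl | rfl)
          exacts [one_mul 1, rr]
        have sr : ∀ s, (s = 1 ∨ s = r) → s * r = r * s := by
          rintro s (rfl | rfl)
          · simp
          · rfl
        have hm : ∃ m, (m = 1 ∨ m = r) ∧ m = s1 * s * s2 := by
          refine ⟨_, ?_, rfl⟩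
          rcases hs with rfl | rfl <;> rcases hs1 with rfl | rfl <;> rcases hs2 with rfl | rfl <;>
            simp [rr]
        obtain ⟨m, hm, em⟩ := hm
        have e1 : s1 * (y * x) * s2 = x * ζ * s * y := by
          calc s1 * (y * x) * s2 = x * (x * y * (x * y)) * y := by
                rw [← es1, ← es2]; simp only [mul_assoc]
            _ = _ := by rw [e]; simp only [mul_assoc]
        have e2 : y * x = ζ * m * (x * y) := by
          calc y * x = (s1 * s1) * (y * x) * (s2 * s2) := by rw [sq _ hs1, sq _ hs2]; simp
            _ = s1 * (s1 * (y * x) * s2) * s2 := by simp only [mul_assoc]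
            _ = (s1 * (x * ζ)) * s * (y * s2) := by rw [e1]; simp only [mul_assoc]
            _ = ((s1 * ζ) * x) * s * (s2 * y) := by rw [zc ζ hζ x, sc s2 hs2 y y1]; simp only [mul_assoc]
            _ = ζ * s1 * (x * s) * s2 * y := by rw [zc ζ hζ s1]; simp only [mul_assoc]
            _ = ζ * s1 * s * (x * s2) * y := by rw [sc s hs x x1]; simp only [mul_assoc]
            _ = ζ * (s1 * s * s2) * (x * y) := by rw [sc s2 hs2 x x1]; simp only [mul_assoc]
            _ = _ := by rw [← em]
        have e3 : x * x * y = ζ * ζ * (x * x * y) := by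
          calc x * x * y = y * (x * x) := by rw [es1, sc s1 hs1 y y1]
            _ = (y * x) * x := by rw [mul_assoc]
            _ = ζ * m * (x * y) * x := by rw [e2]
            _ = ζ * m * x * (y * x) := by simp only [mul_assoc]
            _ = ζ * m * (x * ζ) * m * (x * y) := by rw [e2]; simp only [mul_assoc]
            _ = ζ * (m * ζ) * (x * m) * (x * y) := by rw [zc ζ hζ x]; simp only [mul_assoc]
            _ = ζ * ζ * (m * m) * (x * (x * y)) := by
              rw [zc ζ hζ m, sc m hm x x1]; simp only [mul_assoc]
            _ = _ := by rw [sq m hm]; simp only [mul_one, mul_assoc]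
        have e4 : ζ * ζ = 1 := by
          have := e3.symm
          rwa [mul_eq_right] at this
        rw [z1 ζ (ZQ hζ) e4, one_mul] at e
        have h4 : (x * y) ^ 4 = (x * y * (x * y)) * (x * y * (x * y)) := by
          simp only [pow_succ, pow_zero, one_mul, mul_assoc]
        rw [h4, e, sq s hs] }
  have hL : ∀ y, y ∈ L ↔ y * r = r * y ∧ (∀ q ∈ Q, q * r = r * q → y * q = q * y) ∧ y ^ 4 = 1 :=
    fun y => Iff.rfl
  refine ⟨L, hL, fun y hy => YK y hy.1 hy.2.1, fun y hy => Lsq y hy.1 hy.2.1 hy.2.2, ?_, ?_, ?_, ?_⟩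
  · intro k hk
    obtain ⟨x, rfl⟩ := QuotientGroup.mk_surjective k
    obtain ⟨h, hr, hx⟩ := lift x ((hK x).1 hk).1
    have k4 := four _ hk
    rw [← hx] at hk k4
    have hp : ∀ n : ℕ, h ^ n * r = r * h ^ n := fun n =>
      memCent.1 (pow_mem (memCent.2 hr) n)
    have h3c : ∀ q ∈ Q, q * r = r * q → h ^ 3 * q = q * h ^ 3 := by
      intro q hq hqr
      have h1 := ((hK h).1 hk).2 q hq (by rw [← hqr]; simp)
      set ζ := h * q * h⁻¹ * q⁻¹ with hζ
      have hζc := Subgroup.mem_center_iff.1 h1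
      have e1 : h * q = ζ * q * h := by rw [hζ]; group
      have hζ3 : ζ ^ 3 = 1 := x3 _ (ZQ h1)
      have e2 : h ^ 3 * q = ζ ^ 3 * (q * h ^ 3) := by
        calc h ^ 3 * q = h * (h * (h * q)) := by simp only [pow_succ, pow_zero, one_mul, mul_assoc]
          _ = h * ((h * ζ) * q * h) := by rw [e1]; simp only [mul_assoc]
          _ = h * (ζ * (h * q) * h) := by rw [hζc]; simp only [mul_assoc]
          _ = (h * ζ) * ζ * (q * h * h) := by rw [e1]; simp only [mul_assoc]
          _ = ζ * (h * ζ) * (q * h * h) := by rw [hζc]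
          _ = ζ * ζ * (h * q) * h * h := by rw [hζc]; simp only [mul_assoc]
          _ = ζ ^ 3 * (q * h ^ 3) := by
            rw [e1]; simp only [pow_succ, pow_zero, one_mul, mul_assoc]
      rw [e2, hζ3, one_mul]
    have h9 : h ^ 9 = h ^ 3 * h ^ 3 * h ^ 3 := by simp only [← pow_add]
    refine ⟨h ^ 9, ⟨hp 9, ?_, ?_⟩, ?_⟩
    · rw [h9]; exact Ymul _ _ (Ymul _ _ h3c h3c) h3c
    · have hz := Y4 (h ^ 3) (hp 3) h3c
      have := x3 _ (ZQ hz)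
      simp only [← pow_mul] at this ⊢
      exact this
    · rw [QuotientGroup.mk_pow, show (9 : ℕ) = 4 * 2 + 1 by norm_num, pow_succ, pow_mul, k4, one_pow, one_mul, hx]
  · intro y hy h1
    have hyQ : y ∈ Q := (QuotientGroup.eq_one_iff y).1 h1
    have h3 := x3 y hyQ
    have h4 := hy.2.2
    rwa [pow_succ, h3, one_mul] at h4
  · refine ⟨rfl, rY, ?_⟩
    have : r ^ 4 = (r * r) * (r * r) := by simp only [pow_succ, pow_zero, one_mul, mul_assoc]
    rw [this, rr, one_mul]
  · intro I hI hcop hw x hx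
    have triv : ∀ v ∈ I, v ∈ Q → v = 1 := by
      intro v hv hvQ
      have h3 := orderOf_dvd_of_pow_eq_one (x3 v hvQ)
      have h4 : orderOf v ∣ Nat.card I := Subgroup.orderOf_dvd_natCard I hv
      have := Nat.dvd_gcd h4 h3
      rw [hcop] at this
      exact orderOf_eq_one_iff.1 (Nat.dvd_one.1 this)
    have xr := memCent.1 (hI hx)
    have xc : ∀ q ∈ Q, q * r = r * q → x * q = q * x := by
      intro q hq hqr
      have h1 : q * x * q⁻¹ * x⁻¹ ∈ I := mul_mem (hw q ⟨hq, memCent.2 hqr⟩ x hx) (inv_mem hx)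
      have h2 : q * x * q⁻¹ * x⁻¹ ∈ Q := by
        have := mul_mem hq ((inferInstance : Q.Normal).conj_mem q⁻¹ (inv_mem hq) x)
        simpa only [mul_assoc] using this
      have h3 := triv _ h1 h2
      have h4 : q * x = (q * x * q⁻¹ * x⁻¹) * (x * q) := by group
      rw [h4, h3, one_mul]
    exact ⟨xr, xc, triv _ (pow_mem hx 4) (ZQ (Y4 x xr xc))⟩

end TI

/-- **Lemma 4.7(iii).** Let `H` be similar to a 3-centralizer in a group of type `F₂` with
`Q = O₃(H)`, and let `r ∈ H` be an involution whose image in `H/Q` lies in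
`O₂(H/Q) ∖ Z(O₂(H/Q))`.  Then `O₂(C_H(r)) ≅ 2^{1+4}_-` (extraspecial of order 2⁵ whose
maximal elementary abelian subgroups have order 4), and `O₂(C_H(r))` is the unique maximal
`C_Q(r)`-signalizer in `C_H(r)`: every `C_Q(r)`-invariant subgroup of `C_H(r)` of order
coprime to 3 lies in `O₂(C_H(r))`. -/
theorem stmt_16 {H : Type*} [Group H] [Finite H] (Q : Subgroup H) [Q.Normal]
    (hH : SimilarToF2Centralizer H Q) (r : H) (hr : orderOf r = 2)
    (hrO2 : (r : H ⧸ Q) ∈ Op 2 (H ⧸ Q))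
    (hrnc : (r : H ⧸ Q) ∉ Subgroup.centralizer ((Op 2 (H ⧸ Q)) : Set (H ⧸ Q))) :
    IsExtraspecial 2 (Op 2 (Subgroup.centralizer ({r} : Set H))) ∧
    Nat.card (Op 2 (Subgroup.centralizer ({r} : Set H))) = 2 ^ 5 ∧
    (∀ A : Subgroup (Subgroup.centralizer ({r} : Set H)),
      A ≤ Op 2 (Subgroup.centralizer ({r} : Set H)) → (∀ x ∈ A, x ^ 2 = 1) →
        Nat.card A ≤ 4) ∧
    (∃ A : Subgroup (Subgroup.centralizer ({r} : Set H)),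
      A ≤ Op 2 (Subgroup.centralizer ({r} : Set H)) ∧ (∀ x ∈ A, x ^ 2 = 1) ∧
        Nat.card A = 4) ∧
    ∀ I : Subgroup H, I ≤ Subgroup.centralizer {r} → Nat.Coprime (Nat.card I) 3 →
      (∀ w ∈ Q ⊓ Subgroup.centralizer {r}, ∀ x ∈ I, w * x * w⁻¹ ∈ I) →
      I ≤ Subgroup.map (Subgroup.centralizer ({r} : Set H)).subtype
            (Op 2 (Subgroup.centralizer ({r} : Set H))) := by
  obtain ⟨K, hK, hrK, cardK, hsqK, hcenK, hAK, k0, hk0, hk0s, hk01, hk0r⟩ := dataK Q hH r hr hrO2 hrnc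
  have rr : r * r = 1 := by rw [← pow_two, ← hr]; exact pow_orderOf_eq_one r
  have r1 : r ≠ 1 := by
    rintro rfl
    rw [orderOf_one] at hr
    exact absurd hr (by norm_num)
  obtain ⟨-, hcc, -, -⟩ := hH.extraspecial
  have hcen : ∀ x : Q, x ∈ Subgroup.center Q → (x : H) ∈ Subgroup.center H := by
    intro x h
    rw [← hH.centralizer_eq, Subgroup.mem_centralizer_iff]
    rw [Subgroup.mem_center_iff] at h
    intro y hy
    exact congrArg Subtype.val (h ⟨y, hy⟩)
  have comQ : ∀ x ∈ Q, ∀ y ∈ Q, x * y * x⁻¹ * y⁻¹ ∈ Subgroup.center H := by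
    intro x hx y hy
    have h1 : (⟨x, hx⟩ : Q) * ⟨y, hy⟩ * (⟨x, hx⟩ : Q)⁻¹ * (⟨y, hy⟩ : Q)⁻¹ ∈ Subgroup.center Q := by
      rw [hcc, ← commutatorElement_def, commutator_def]
      exact Subgroup.commutator_mem_commutator (Subgroup.mem_top _) (Subgroup.mem_top _)
    exact hcen _ h1
  obtain ⟨L, hL, hLK, hLsq, hLs, hLi, hrL, hLI⟩ := existsL Q r rr r1 hH.exponent3 hH.center_le
    (fun x hx => by
      rw [← hH.centralizer_eq, Subgroup.mem_centralizer_iff]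
      exact fun q hq => (hx q hq).symm) comQ K hK hsqK
  have hinj : ∀ x ∈ L, ∀ y ∈ L, (x : H ⧸ Q) = (y : H ⧸ Q) → x = y := by
    intro x hx y hy e
    have := hLi (x * y⁻¹) (mul_mem hx (inv_mem hy)) (by
      rw [QuotientGroup.mk_mul, QuotientGroup.mk_inv, e, mul_inv_cancel])
    exact mul_inv_eq_one.1 this
  set C := Subgroup.centralizer ({r} : Set H) with hC
  have hLC : L ≤ C := fun y hy => memCent.2 ((hL y).1 hy).1
  have hOp : Op 2 C = L.subgroupOf C := by
    apply le_antisymm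
    · refine sSup_le ?_
      rintro P ⟨hPn, hP2⟩
      have : P.map C.subtype ≤ L := by
        apply hLI
        · exact Subgroup.map_subtype_le P
        · rw [Nat.card_congr (P.equivMapOfInjective C.subtype C.subtype_injective).symm.toEquiv]
          obtain ⟨n, hn⟩ := IsPGroup.iff_card.1 hP2
          rw [hn]
          exact Nat.Coprime.pow_left n (by norm_num)
        · rintro w ⟨hwQ, hwC⟩ _ ⟨x, hx, rfl⟩
          exact ⟨⟨w, hwC⟩ * x * ⟨w, hwC⟩⁻¹, hPn.conj_mem x hx _, rfl⟩
      intro x hx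
      exact this ⟨x, hx, rfl⟩
    · refine le_sSup ⟨⟨?_⟩, ?_⟩
      · rintro ⟨y, hyC⟩ hy ⟨g, hg⟩
        have hy' : y ∈ L := hy
        obtain ⟨h1, h2, h3⟩ := (hL y).1 hy'
        have hg' := memCent.1 hg
        show g * y * g⁻¹ ∈ L
        refine (hL _).2 ⟨cmul (cmul hg' h1) (cinv hg'), ?_, by rw [conj_pow, h3]; simp⟩
        intro q hq hqr
        have h4 := h2 (g⁻¹ * q * g) (by
          have := (inferInstance : Q.Normal).conj_mem q hq g⁻¹
          simpa using this) (cmul (cmul (cinv hg') hqr) hg')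
        calc g * y * g⁻¹ * q = g * (y * (g⁻¹ * q * g)) * g⁻¹ := by group
          _ = q * (g * y * g⁻¹) := by rw [h4]; group
      · rintro ⟨⟨y, hyC⟩, hy⟩
        refine ⟨2, ?_⟩
        have hy' : y ∈ L := hy
        apply Subtype.ext
        apply Subtype.ext
        exact ((hL y).1 hy').2.2
  rw [hOp]
  have rC : r ∈ C := hLC hrL
  refine ⟨?_, ?_, ?_, ?_, ?_⟩
  · refine extraspecial_of (⟨⟨r, rC⟩, hrL⟩ : L.subgroupOf C) ?_ ?_ ?_ ?_ ?_ ?_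
    · intro h
      exact r1 (congrArg (fun x : L.subgroupOf C => ((x : C) : H)) h)
    · exact Subtype.ext (Subtype.ext rr)
    · rintro ⟨⟨x, hxC⟩, hx⟩
      exact Subtype.ext (Subtype.ext (memCent.1 hxC))
    · rintro ⟨⟨x, hxC⟩, hx⟩
      rcases hLsq x hx with h | h
      · exact Or.inl (Subtype.ext (Subtype.ext h))
      · exact Or.inr (Subtype.ext (Subtype.ext h))
    · rintro ⟨⟨x, hxC⟩, hx⟩ hall
      have hx' : x ∈ L := hx
      have : (x : H ⧸ Q) = 1 ∨ (x : H ⧸ Q) = (r : H ⧸ Q) := by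
        apply hcenK _ (hLK x hx')
        intro k hk
        obtain ⟨y, hy, rfl⟩ := hLs k hk
        have := congrArg (fun x : L.subgroupOf C => ((x : C) : H)) (hall ⟨⟨y, hLC hy⟩, hy⟩)
        exact congrArg (fun x : H => (x : H ⧸ Q)) this
      rcases this with h | h
      · exact Or.inl (Subtype.ext (Subtype.ext (hLi x hx' h)))
      · exact Or.inr (Subtype.ext (Subtype.ext (hinj x hx' r hrL h)))
    · intro hall
      obtain ⟨y, hy, e⟩ := hLs k0 hk0
      rcases hall ⟨⟨y, hLC hy⟩, hy⟩ with h | h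
      · have := congrArg (fun x : L.subgroupOf C => ((x : C) : H)) h
        have h2 : y = 1 := this
        exact hk01 (by rw [← e, h2]; rfl)
      · have := congrArg (fun x : L.subgroupOf C => ((x : C) : H)) h
        have h2 : y = r := this
        exact hk0r (by rw [← e, h2])
  · have : Nat.card (L.subgroupOf C) = Nat.card K := by
      refine Nat.card_eq_of_bijective
        (fun x : L.subgroupOf C => (⟨(((x : C) : H) : H ⧸ Q), hLK _ x.2⟩ : K)) ⟨?_, ?_⟩
      · rintro ⟨⟨x, hxC⟩, hx⟩ ⟨⟨y, hyC⟩, hy⟩ e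
        exact Subtype.ext (Subtype.ext (hinj x hx y hy (congrArg Subtype.val e)))
      · rintro ⟨k, hk⟩
        obtain ⟨y, hy, e⟩ := hLs k hk
        exact ⟨⟨⟨y, hLC hy⟩, hy⟩, Subtype.ext e⟩
    rw [this, cardK]
    norm_num
  · intro A hA hA2
    let f : C →* H ⧸ Q := (QuotientGroup.mk' Q).comp C.subtype
    refine le_trans ?_ (hAK (A.map f) ?_ ?_)
    · refine Nat.card_le_card_of_injective (fun x : A => (⟨f x, ⟨x, x.2, rfl⟩⟩ : A.map f)) ?_
      rintro ⟨x, hx⟩ ⟨y, hy⟩ e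
      exact Subtype.ext (Subtype.ext (hinj x (hA hx) y (hA hy) (congrArg Subtype.val e)))
    · rintro _ ⟨x, hx, rfl⟩
      exact hLK _ (hA hx)
    · rintro _ ⟨x, hx, rfl⟩
      rw [← map_mul, ← pow_two, hA2 x hx, map_one]
  · obtain ⟨k, hk, e⟩ := hLs k0 hk0
    have k1 : k ≠ 1 := by
      rintro rfl
      exact hk01 e.symm
    have kr : k ≠ r := by
      rintro rfl
      exact hk0r e.symm
    have kk : k * k = 1 := by
      apply hLi _ (mul_mem hk hk)
      rw [QuotientGroup.mk_mul, e, hk0s]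
    have hkr : k * r = r * k := ((hL k).1 hk).1
    have a1 : r * (r * k) = k := by rw [← mul_assoc, rr, one_mul]
    have a2 : k * (r * k) = r := by rw [← mul_assoc, hkr, mul_assoc, kk, mul_one]
    have a3 : r * k * r = k := by rw [mul_assoc, hkr, a1]
    have a4 : r * k * k = r := by rw [mul_assoc, kk, mul_one]
    have a5 : r * k * (r * k) = 1 := by rw [mul_assoc, a2, rr]
    let B : Subgroup H :=
      { carrier := {1, r, k, r * k}
        one_mem' := by simp
        mul_mem' := by
          intro a b ha hb
          simp only [Set.mem_insert_iff, Set.mem_singleton_iff] at ha hb ⊢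
          rcases ha with rfl | rfl | rfl | rfl <;> rcases hb with rfl | rfl | rfl | rfl <;>
            simp only [one_mul, mul_one, rr, kk, hkr, a1, a2, a3, a4, a5, true_or, or_true]
        inv_mem' := by
          intro a ha
          simp only [Set.mem_insert_iff, Set.mem_singleton_iff] at ha ⊢
          have : a⁻¹ = a := by
            rcases ha with rfl | rfl | rfl | rfl
            · exact inv_one
            · exact inv_eq_of_mul_eq_one_left rr
            · exact inv_eq_of_mul_eq_one_left kk
            · exact inv_eq_of_mul_eq_one_left a5
          rw [this]; exact ha }
    have hBL : B ≤ L := by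
      intro a ha
      have ha' : a = 1 ∨ a = r ∨ a = k ∨ a = r * k := ha
      rcases ha' with rfl | rfl | rfl | rfl
      exacts [one_mem L, hrL, hk, mul_mem hrL hk]
    refine ⟨B.subgroupOf C, fun x hx => hBL hx, ?_, ?_⟩
    · rintro ⟨x, hxC⟩ hx
      have ha' : x = 1 ∨ x = r ∨ x = k ∨ x = r * k := hx
      apply Subtype.ext
      show x ^ 2 = 1
      rw [pow_two]
      rcases ha' with rfl | rfl | rfl | rfl
      exacts [one_mul 1, rr, kk, a5]
    · rw [Nat.card_congr (Subgroup.subgroupOfEquivOfLe (hBL.trans hLC)).toEquiv]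
      show Nat.card (({1, r, k, r * k} : Set H)) = 4
      rw [Nat.card_coe_set_eq, Set.ncard_insert_of_notMem, Set.ncard_insert_of_notMem, Set.ncard_pair]
      · intro h
        exact r1 (right_eq_mul.1 h)
      · simp only [Set.mem_insert_iff, Set.mem_singleton_iff, not_or]
        exact ⟨fun h => kr h.symm, fun h => k1 (left_eq_mul.1 h)⟩
      · simp only [Set.mem_insert_iff, Set.mem_singleton_iff, not_or]
        refine ⟨r1.symm, k1.symm, fun h => kr ?_⟩
        rw [← mul_one r, h, a1]
  · intro I hI hcop hw x hx
    exact ⟨⟨x, hI hx⟩, hLI I hI hcop hw hx, rfl⟩
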